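/- arXiv:1403.2649 — 2 statements merged into one kernel-verified Lean document; each statement's English description precedes it below -/
import Mathlib

section
/- Let Ω be a nondegenerate triangle in ℝ², let s ≥ 1 and k ≥ 0 be integers, N = 4^k, and let P = (f_Ω(s), f_Ω(s+1), …, f_Ω(s+N−1)) be any block of N consecutive triangular van der Corput points of Ω. Then D_N^P(P;Ω) ≤ 2/√N − 1/N. -/
open MeasureTheory Filter Real

noncomputable section

/-- Points of the plane. -/
abbrev Pt := ℝ × ℝ

/-- The (closed) triangle with vertices `A`, `B`, `C`: their convex hull. -/
def triangle (A B C : Pt) : Set Pt := convexHull ℝ {A, B, C}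

/-- The triangle `Δ(A,B,C)` is nondegenerate iff `A`, `B`, `C` are not collinear. -/
def Nondeg (A B C : Pt) : Prop := ¬ Collinear ℝ ({A, B, C} : Set Pt)

/-- Two-dimensional Lebesgue volume, as a real number. -/
def vol (S : Set Pt) : ℝ := (volume S).toReal

/-- Signed discrepancy `δ_N(S; P, Ω)` of the list of points `P` at the set `S`,
relative to the domain `Ω`. -/
def sdisc {N : ℕ} (S : Set Pt) (P : Fin N → Pt) (Ω : Set Pt) : ℝ :=
  vol (S ∩ Ω) / vol Ω - (Nat.card {i : Fin N // P i ∈ S} : ℝ) / N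

/-- Discrepancy `D_N(𝒮; P, Ω)`: supremum of the absolute signed discrepancy
over a class `𝒮` of sets. -/
def Disc {N : ℕ} (𝒮 : Set (Set Pt)) (P : Fin N → Pt) (Ω : Set Pt) : ℝ :=
  ⨆ S ∈ 𝒮, |sdisc S P Ω|

/-- The half-open parallelogram `𝒯_{a,b,C}` anchored at `C` with sides
`a(A-C)` and `b(B-C)`. -/
def parlg (A B C : Pt) (a b : ℝ) : Set Pt :=
  {x | ∃ s t : ℝ, 0 ≤ s ∧ s < a ∧ 0 ≤ t ∧ t < b ∧ x = C + s • (A - C) + t • (B - C)}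

/-- The family `𝒮_C` of parallelograms anchored at `C`, intersected with the triangle. -/
def anchoredFam (A B C : Pt) : Set (Set Pt) :=
  {S | ∃ a b : ℝ, 0 < a ∧ a ≤ 1 ∧ 0 < b ∧ b ≤ 1 ∧ S = parlg A B C a b ∩ triangle A B C}

/-- The class `𝒮_A ∪ 𝒮_B ∪ 𝒮_C` of anchored parallelograms of the triangle `Δ(A,B,C)`. -/
def parFam (A B C : Pt) : Set (Set Pt) :=
  anchoredFam B C A ∪ anchoredFam A C B ∪ anchoredFam A B C

/-- The parallelogram discrepancy `D_N^P(P; Δ(A,B,C))`. -/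
def parDisc {N : ℕ} (P : Fin N → Pt) (A B C : Pt) : ℝ :=
  Disc (parFam A B C) P (triangle A B C)

/-- Midpoint of two points. -/
def mid (P Q : Pt) : Pt := (2⁻¹ : ℝ) • (P + Q)

/-- A triangle recorded as the (ordered) triple of its vertices. -/
abbrev Tri2 := Pt × Pt × Pt

/-- The centroid of a triangle: the average of its three vertices. -/
def ctr (T : Tri2) : Pt := (3⁻¹ : ℝ) • (T.1 + T.2.1 + T.2.2)

/-- The point set of a triangle given by its vertices. -/
def triSet (T : Tri2) : Set Pt := triangle T.1 T.2.1 T.2.2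

/-- The four-way subdivision of a triangle: subtriangle number `d ∈ {0,1,2,3}`. -/
def subdiv (T : Tri2) (d : ℕ) : Tri2 :=
  let A := T.1; let B := T.2.1; let C := T.2.2
  if d = 0 then (mid B C, mid A C, mid A B)
  else if d = 1 then (A, mid A B, mid A C)
  else if d = 2 then (mid A B, B, mid B C)
  else (mid A C, mid B C, C)

/-- The triangular van der Corput point `f_T(i)`: digits of `i` in base `4` select a
nested subtriangle, and `f_T(i)` is its centroid. -/
def vdc (T : Tri2) (i : ℕ) : Pt :=
  if h : i = 0 then ctr T else vdc (subdiv T (i % 4)) (i / 4)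
termination_by i
decreasing_by exact Nat.div_lt_self (Nat.pos_of_ne_zero h) (by norm_num)

/-- The `i`-th subtriangle (for `i < 4^k`) of the standard level-`k` subdivision of `T`,
indexed by the base-4 digits of `i`. -/
def subdivAt (T : Tri2) : ℕ → ℕ → Tri2
  | 0, _ => T
  | (k+1), i => subdiv (subdivAt T k (i / 4)) (i % 4)

/-- The standard level-`k` subdivision of a triangle: the set of the `4^k` congruent
subtriangles obtained by `k` recursive four-way subdivisions. -/
def level (T : Tri2) : ℕ → Set Tri2
  | 0 => {T}
  | (k+1) => {S | ∃ S' ∈ level T k, ∃ d < 4, S = subdiv S' d}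

/-- Riemann integrability (in the triangular-subdivision sense) of `f` on the closed
triangle `T`, with integral mean `μ`: every sequence of tagged Riemann sums over the
level-`k` subdivisions converges to `μ`. -/
def RiemannMean (T : Tri2) (f : Pt → ℝ) (μ : ℝ) : Prop :=
  ∀ x : ℕ → ℕ → Pt, (∀ k i, i < 4^k → x k i ∈ triSet (subdivAt T k i)) →
    Tendsto (fun k => (4^k : ℝ)⁻¹ * ∑ i ∈ Finset.range (4^k), f (x k i)) atTop (nhds μ)

/-- A real number is a quadratic irrational if it has the form `(a + b√c)/d` with
integers `a,b,c,d`, `b ≠ 0`, `d ≠ 0`, `c > 0` and `c` not a perfect square. -/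
def QuadIrr (θ : ℝ) : Prop :=
  ∃ a b c d : ℤ, b ≠ 0 ∧ d ≠ 0 ∧ 0 < c ∧ (∀ m : ℤ, c ≠ m ^ 2) ∧
    θ = ((a : ℝ) + (b : ℝ) * Real.sqrt (c : ℝ)) / (d : ℝ)

/-- Distance from a real number to the nearest integer. -/
def distToInt (x : ℝ) : ℝ := |x - round x|

/-- A real number `θ` is badly approximable if `n‖nθ‖ > c` for all positive `n`,
for some constant `c > 0`. -/
def BadlyApprox (θ : ℝ) : Prop :=
  ∃ c : ℝ, 0 < c ∧ ∀ n : ℕ, 0 < n → c < (n : ℝ) * distToInt ((n : ℝ) * θ)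

end

noncomputable section

/-- The barycentric coordinate of the `i`-th van der Corput point with respect to the vertex
that attracts the digit `a ∈ {1, 2, 3}`. -/
def vdcCoord (a i : ℕ) : ℝ :=
  if h : i = 0 then 3⁻¹
  else if i % 4 = 0 then (1 - vdcCoord a (i / 4)) / 2
  else if i % 4 = a then (1 + vdcCoord a (i / 4)) / 2
  else vdcCoord a (i / 4) / 2
termination_by i
decreasing_by all_goals exact Nat.div_lt_self (Nat.pos_of_ne_zero h) (by norm_num)

theorem vdcCoord_zero (a : ℕ) : vdcCoord a 0 = 3⁻¹ := by
  rw [vdcCoord, dif_pos rfl]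

theorem vdcCoord_eq (a i : ℕ) :
    vdcCoord a i = if i % 4 = 0 then (1 - vdcCoord a (i / 4)) / 2
      else if i % 4 = a then (1 + vdcCoord a (i / 4)) / 2
      else vdcCoord a (i / 4) / 2 := by
  by_cases h : i = 0
  · subst h
    simp only [Nat.zero_mod, Nat.zero_div, if_true, vdcCoord_zero]
    norm_num
  · conv_lhs => rw [vdcCoord, dif_neg h]

theorem vdcCoord_four_mul (a j : ℕ) : vdcCoord a (4 * j) = (1 - vdcCoord a j) / 2 := by
  rw [vdcCoord_eq, if_pos (by omega), show 4 * j / 4 = j by omega]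

theorem vdcCoord_four_mul_add_self {a : ℕ} (ha : 1 ≤ a) (ha' : a ≤ 3) (j : ℕ) :
    vdcCoord a (4 * j + a) = (1 + vdcCoord a j) / 2 := by
  rw [vdcCoord_eq, if_neg (by omega), if_pos (by omega), show (4 * j + a) / 4 = j by omega]

theorem vdcCoord_four_mul_add_of_ne {a d : ℕ} (hd : 1 ≤ d) (hd' : d ≤ 3) (h : d ≠ a) (j : ℕ) :
    vdcCoord a (4 * j + d) = vdcCoord a j / 2 := by
  rw [vdcCoord_eq, if_neg (by omega), if_neg (by omega), show (4 * j + d) / 4 = j by omega]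

theorem vdcCoord_mem_Ioo (a i : ℕ) : 0 < vdcCoord a i ∧ vdcCoord a i < 1 := by
  induction i using Nat.strong_induction_on with
  | _ i ih =>
    by_cases h : i = 0
    · subst h
      rw [vdcCoord_zero]
      norm_num
    · have := ih (i / 4) (Nat.div_lt_self (Nat.pos_of_ne_zero h) (by norm_num))
      rw [vdcCoord_eq]
      split_ifs <;> constructor <;> linarith

theorem vdcCoord_sum (i : ℕ) : vdcCoord 1 i + vdcCoord 2 i + vdcCoord 3 i = 1 := by
  induction i using Nat.strong_induction_on with
  | _ i ih =>
    by_cases h : i = 0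
    · subst h
      simp only [vdcCoord_zero]
      norm_num
    · have := ih (i / 4) (Nat.div_lt_self (Nat.pos_of_ne_zero h) (by norm_num))
      rw [vdcCoord_eq 1 i, vdcCoord_eq 2 i, vdcCoord_eq 3 i]
      have h4 : i % 4 < 4 := Nat.mod_lt _ (by norm_num)
      interval_cases i % 4 <;> norm_num <;> linarith

/-- In lowest terms, coordinates of van der Corput points have denominators divisible by `3`. -/
theorem vdcCoord_eq_div (a i : ℕ) :
    ∃ (K : ℕ) (m : ℤ), ¬ (3 : ℤ) ∣ m ∧ 3 * 2 ^ K * vdcCoord a i = m := by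
  induction i using Nat.strong_induction_on with
  | _ i ih =>
    by_cases h : i = 0
    · subst h
      exact ⟨0, 1, by norm_num, by rw [vdcCoord_zero]; norm_num⟩
    · obtain ⟨K, m, hm, e⟩ := ih (i / 4) (Nat.div_lt_self (Nat.pos_of_ne_zero h) (by norm_num))
      rw [vdcCoord_eq]
      split_ifs
      · refine ⟨K + 1, 3 * 2 ^ K - m, by omega, ?_⟩
        push_cast
        rw [← e]
        ring
      · refine ⟨K + 1, 3 * 2 ^ K + m, by omega, ?_⟩
        push_cast
        rw [← e]
        ring
      · refine ⟨K + 1, m, hm, ?_⟩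
        rw [← e]
        ring

theorem two_pow_mul_vdcCoord_ne (a i k : ℕ) (z : ℤ) : 2 ^ k * vdcCoord a i ≠ z := by
  intro h
  obtain ⟨K, m, hm, e⟩ := vdcCoord_eq_div a i
  have h1 : (m : ℝ) * 2 ^ k = 3 * (2 ^ K * z) := by
    rw [← e, ← h]
    ring
  have h2 : m * 2 ^ k = 3 * (2 ^ K * z) := by exact_mod_cast h1
  have h3 : (3 : ℤ) ∣ m * 2 ^ k := ⟨_, h2⟩
  rcases Int.prime_three.dvd_or_dvd h3 with h4 | h4
  · exact hm h4
  · have := Int.prime_three.dvd_of_dvd_pow h4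
    omega

theorem vdc_eq (T : Tri2) (i : ℕ) : vdc T i = vdc (subdiv T (i % 4)) (i / 4) := by
  by_cases h : i = 0
  · subst h
    rw [vdc, vdc, dif_pos rfl, dif_pos (by norm_num)]
    ext <;> simp [ctr, subdiv, mid] <;> ring
  · conv_lhs => rw [vdc, dif_neg h]

theorem vdc_eq_sum (T : Tri2) (i : ℕ) :
    vdc T i = vdcCoord 1 i • T.1 + vdcCoord 2 i • T.2.1 + vdcCoord 3 i • T.2.2 := by
  induction i using Nat.strong_induction_on generalizing T with
  | _ i ih =>
    by_cases h : i = 0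
    · subst h
      rw [vdc, dif_pos rfl]
      simp only [vdcCoord_zero, ctr, smul_add]
    · rw [vdc_eq, ih (i / 4) (Nat.div_lt_self (Nat.pos_of_ne_zero h) (by norm_num))]
      have hs := vdcCoord_sum (i / 4)
      rw [vdcCoord_eq 1 i, vdcCoord_eq 2 i, vdcCoord_eq 3 i]
      have h3 : vdcCoord 3 (i / 4) = 1 - vdcCoord 1 (i / 4) - vdcCoord 2 (i / 4) := by linarith
      have h4 : i % 4 < 4 := Nat.mod_lt _ (by norm_num)
      rw [h3]
      ext <;> interval_cases i % 4 <;> simp [subdiv, mid] <;> ring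

/-- A sum over a block of `4 * M` consecutive integers, split by residues modulo `4`. -/
theorem exists_sum_block_split (s M : ℕ) : ∃ t₀ t₁ t₂ t₃ : ℕ, ∀ g : ℕ → ℤ,
    ∑ i ∈ Finset.range (4 * M), g (s + i) =
      ∑ i ∈ Finset.range M, g (4 * (t₀ + i)) + ∑ i ∈ Finset.range M, g (4 * (t₁ + i) + 1) +
      ∑ i ∈ Finset.range M, g (4 * (t₂ + i) + 2) + ∑ i ∈ Finset.range M, g (4 * (t₃ + i) + 3) := by
  refine ⟨(s + 3) / 4, (s + 2) / 4, (s + 1) / 4, s / 4, fun g => ?_⟩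
  induction M with
  | zero => simp
  | succ M ih =>
    rw [show 4 * (M + 1) = 4 * M + 1 + 1 + 1 + 1 by ring]
    simp only [Finset.sum_range_succ, ih]
    obtain ⟨t, r, hr, rfl⟩ : ∃ t r, r < 4 ∧ s = 4 * t + r :=
      ⟨s / 4, s % 4, Nat.mod_lt _ (by norm_num), by omega⟩
    have key : g (4 * t + r + 4 * M) + g (4 * t + r + (4 * M + 1)) +
        g (4 * t + r + (4 * M + 1 + 1)) + g (4 * t + r + (4 * M + 1 + 1 + 1)) =
        g (4 * ((4 * t + r + 3) / 4 + M)) + g (4 * ((4 * t + r + 2) / 4 + M) + 1) +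
        g (4 * ((4 * t + r + 1) / 4 + M) + 2) + g (4 * ((4 * t + r) / 4 + M) + 3) := by
      interval_cases r
      · rw [show (4 * t + 0 + 3) / 4 = t by omega, show (4 * t + 0 + 2) / 4 = t by omega,
          show (4 * t + 0 + 1) / 4 = t by omega, show (4 * t + 0) / 4 = t by omega]
        ring_nf
      · rw [show (4 * t + 1 + 3) / 4 = t + 1 by omega, show (4 * t + 1 + 2) / 4 = t by omega,
          show (4 * t + 1 + 1) / 4 = t by omega, show (4 * t + 1) / 4 = t by omega]
        ring_nf
      · rw [show (4 * t + 2 + 3) / 4 = t + 1 by omega, show (4 * t + 2 + 2) / 4 = t + 1 by omega,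
          show (4 * t + 2 + 1) / 4 = t by omega, show (4 * t + 2) / 4 = t by omega]
        ring_nf
      · rw [show (4 * t + 3 + 3) / 4 = t + 1 by omega, show (4 * t + 3 + 2) / 4 = t + 1 by omega,
          show (4 * t + 3 + 1) / 4 = t + 1 by omega, show (4 * t + 3) / 4 = t by omega]
        ring_nf
    linarith

/-- The number of indices in the block `s, …, s + 4 ^ k - 1` whose coordinates `a` and `b`,
scaled by `2 ^ k`, are below `x` and `y`. -/
def blockCount (a b k s : ℕ) (x y : ℝ) : ℤ :=
  ∑ i ∈ Finset.range (4 ^ k),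
    if 2 ^ k * vdcCoord a (s + i) < x ∧ 2 ^ k * vdcCoord b (s + i) < y then 1 else 0

theorem blockCount_mono (a b k s : ℕ) {x x' y y' : ℝ} (hx : x ≤ x') (hy : y ≤ y') :
    blockCount a b k s x y ≤ blockCount a b k s x' y' := by
  refine Finset.sum_le_sum fun i _ => ?_
  split_ifs with h1 h2
  · exact le_rfl
  · exact absurd ⟨h1.1.trans_le hx, h1.2.trans_le hy⟩ h2
  · exact zero_le_one
  · exact le_rfl

theorem blockCount_of_nonpos_left (a b k s : ℕ) {x : ℝ} (y : ℝ) (hx : x ≤ 0) :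
    blockCount a b k s x y = 0 := by
  refine Finset.sum_eq_zero fun i _ => if_neg fun h => ?_
  have := mul_pos (pow_pos two_pos k) (vdcCoord_mem_Ioo a (s + i)).1
  linarith [h.1]

theorem blockCount_comm (a b k s : ℕ) (x y : ℝ) :
    blockCount a b k s x y = blockCount b a k s y x := by
  simp only [blockCount, and_comm]

theorem blockCount_of_ge_left (a b k s : ℕ) {x : ℝ} (y : ℝ) (hx : 2 ^ k ≤ x) :
    blockCount a b k s x y = blockCount a b k s (2 ^ k) y := by
  refine Finset.sum_congr rfl fun i _ => ?_
  have h : (2 : ℝ) ^ k * vdcCoord a (s + i) < 2 ^ k :=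
    mul_lt_of_lt_one_right (pow_pos two_pos k) (vdcCoord_mem_Ioo a (s + i)).2
  simp only [h, h.trans_le hx, true_and]

theorem blockCount_of_nonpos_right (a b k s : ℕ) (x : ℝ) {y : ℝ} (hy : y ≤ 0) :
    blockCount a b k s x y = 0 := by
  rw [blockCount_comm, blockCount_of_nonpos_left _ _ _ _ _ hy]

theorem blockCount_of_ge_right (a b k s : ℕ) (x : ℝ) {y : ℝ} (hy : 2 ^ k ≤ y) :
    blockCount a b k s x y = blockCount a b k s x (2 ^ k) := by
  rw [blockCount_comm, blockCount_of_ge_left _ _ _ _ _ hy, blockCount_comm]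

theorem blockCount_two_pow (a b k s : ℕ) : blockCount a b k s (2 ^ k) (2 ^ k) = 4 ^ k := by
  have h (c i : ℕ) : (2 : ℝ) ^ k * vdcCoord c i < 2 ^ k :=
    mul_lt_of_lt_one_right (pow_pos two_pos k) (vdcCoord_mem_Ioo c i).2
  simp [blockCount, h]

/-- The number of subtriangles in the first `p` columns and the first `q` rows of the
subdivision of a triangle into `n ^ 2` congruent ones. -/
def gridCount (n p q : ℤ) : ℤ := 2 * p * q - (max 0 (p + q - n)) ^ 2

theorem sum_reflected (a b k s : ℕ) (p q : ℤ) :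
    (∑ i ∈ Finset.range (4 ^ k),
      if 2 ^ (k + 1) * ((1 - vdcCoord a (s + i)) / 2) < (p : ℝ) ∧
        2 ^ (k + 1) * ((1 - vdcCoord b (s + i)) / 2) < (q : ℝ) then (1 : ℤ) else 0) =
    4 ^ k - blockCount a b k s (2 ^ k - p) (2 ^ k) - blockCount a b k s (2 ^ k) (2 ^ k - q) +
      blockCount a b k s (2 ^ k - p) (2 ^ k - q) := by
  rw [← blockCount_two_pow a b k s]
  simp only [blockCount]
  rw [← Finset.sum_sub_distrib, ← Finset.sum_sub_distrib, ← Finset.sum_add_distrib]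
  refine Finset.sum_congr rfl fun i _ => ?_
  have h1 (c i : ℕ) : (2 : ℝ) ^ k * vdcCoord c i < 2 ^ k :=
    mul_lt_of_lt_one_right (pow_pos two_pos k) (vdcCoord_mem_Ioo c i).2
  have h2 (c i : ℕ) (z : ℤ) : 2 ^ (k + 1) * ((1 - vdcCoord c i) / 2) < (z : ℝ) ↔
      ¬ (2 ^ k * vdcCoord c i < 2 ^ k - (z : ℝ)) := by
    have h3 := two_pow_mul_vdcCoord_ne c i k (2 ^ k - z)
    push_cast at h3
    rw [pow_succ, not_lt, (Ne.symm h3).le_iff_lt]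
    constructor <;> intro h <;> linarith
  simp only [h1, h2, and_true, true_and]
  split_ifs <;> simp_all

theorem blockCount_succ {a b : ℕ} (h : (a = 1 ∧ b = 2) ∨ (a = 2 ∧ b = 3) ∨ (a = 1 ∧ b = 3))
    (k s : ℕ) : ∃ t₀ t₁ t₂ t₃ : ℕ, ∀ p q : ℤ,
    blockCount a b (k + 1) s p q =
      4 ^ k - blockCount a b k t₀ (2 ^ k - p) (2 ^ k) - blockCount a b k t₀ (2 ^ k) (2 ^ k - q) +
      blockCount a b k t₀ (2 ^ k - p) (2 ^ k - q) +
      blockCount a b k t₁ (p - 2 ^ k) q + blockCount a b k t₂ p (q - 2 ^ k) +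
      blockCount a b k t₃ p q := by
  obtain ⟨t₀, t₁, t₂, t₃, ht⟩ := exists_sum_block_split s (4 ^ k)
  have e1 (x y : ℝ) : 2 ^ (k + 1) * ((1 + x) / 2) < y ↔ 2 ^ k * x < y - 2 ^ k := by
    rw [pow_succ]
    constructor <;> intro h <;> linarith
  have e2 (x y : ℝ) : 2 ^ (k + 1) * (x / 2) < y ↔ 2 ^ k * x < y := by
    rw [pow_succ]
    constructor <;> intro h <;> linarith
  rcases h with ⟨rfl, rfl⟩ | ⟨rfl, rfl⟩ | ⟨rfl, rfl⟩
  · refine ⟨t₀, t₁, t₂, t₃, fun p q => ?_⟩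
    rw [← sum_reflected, blockCount, pow_succ' 4, ht fun j =>
      if 2 ^ (k + 1) * vdcCoord 1 j < (p : ℝ) ∧ 2 ^ (k + 1) * vdcCoord 2 j < (q : ℝ)
        then 1 else 0]
    simp [blockCount, vdcCoord_four_mul, vdcCoord_four_mul_add_self, vdcCoord_four_mul_add_of_ne,
      e1, e2]
  · refine ⟨t₀, t₂, t₃, t₁, fun p q => ?_⟩
    rw [← sum_reflected, blockCount, pow_succ' 4, ht fun j =>
      if 2 ^ (k + 1) * vdcCoord 2 j < (p : ℝ) ∧ 2 ^ (k + 1) * vdcCoord 3 j < (q : ℝ)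
        then 1 else 0]
    simp [blockCount, vdcCoord_four_mul, vdcCoord_four_mul_add_self, vdcCoord_four_mul_add_of_ne,
      e1, e2]
    ring
  · refine ⟨t₀, t₁, t₃, t₂, fun p q => ?_⟩
    rw [← sum_reflected, blockCount, pow_succ' 4, ht fun j =>
      if 2 ^ (k + 1) * vdcCoord 1 j < (p : ℝ) ∧ 2 ^ (k + 1) * vdcCoord 3 j < (q : ℝ)
        then 1 else 0]
    simp [blockCount, vdcCoord_four_mul, vdcCoord_four_mul_add_self, vdcCoord_four_mul_add_of_ne,
      e1, e2]
    ring

theorem blockCount_eq_gridCount {a b : ℕ}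
    (h : (a = 1 ∧ b = 2) ∨ (a = 2 ∧ b = 3) ∨ (a = 1 ∧ b = 3))
    (k s : ℕ) {p q : ℤ} (hp : 0 ≤ p) (hp' : p ≤ 2 ^ k) (hq : 0 ≤ q) (hq' : q ≤ 2 ^ k) :
    blockCount a b k s p q = gridCount (2 ^ k) p q := by
  induction k generalizing s p q with
  | zero =>
    have ha := vdcCoord_mem_Ioo a s
    have hb := vdcCoord_mem_Ioo b s
    have hp1 : p < 2 := by norm_num at hp'; omega
    have hq1 : q < 2 := by norm_num at hq'; omega
    interval_cases p <;> interval_cases q <;>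
      simp [blockCount, gridCount, ha.1.le, hb.1.le, ha.2, hb.2,
        -Finset.sum_boole]
  | succ k ih =>
    obtain ⟨t₀, t₁, t₂, t₃, ht⟩ := blockCount_succ h k s
    rw [ht]
    have hn : (0 : ℤ) < 2 ^ k := by positivity
    have h4 : (4 : ℤ) ^ k = 2 ^ k * 2 ^ k := by rw [← mul_pow]; norm_num
    rw [pow_succ] at hp' hq' ⊢
    have ecast (t : ℕ) {p' q' : ℤ} {x y : ℝ} (hx : x = p') (hy : y = q') (h1 : 0 ≤ p')
        (h2 : p' ≤ 2 ^ k) (h3 : 0 ≤ q') (h4 : q' ≤ 2 ^ k) :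
        blockCount a b k t x y = gridCount (2 ^ k) p' q' := by
      rw [hx, hy, ih t h1 h2 h3 h4]
    have hpk (z : ℤ) : z ≤ 2 ^ k ↔ (z : ℝ) ≤ 2 ^ k := by
      rw [← Int.cast_le (R := ℝ)]; push_cast; rfl
    have hkp (z : ℤ) : 2 ^ k ≤ z ↔ 2 ^ k ≤ (z : ℝ) := by
      rw [← Int.cast_le (R := ℝ)]; push_cast; rfl
    rcases le_total p (2 ^ k) with h1 | h1 <;> rcases le_total q (2 ^ k) with h2 | h2
    · rw [blockCount_of_nonpos_left (x := p - 2 ^ k) (hx := by linarith [(hpk p).1 h1]),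
        blockCount_of_nonpos_right (y := q - 2 ^ k) (hy := by linarith [(hpk q).1 h2]),
        ecast t₀ (p' := 2 ^ k - p) (q' := 2 ^ k) (by simp) (by simp) (by omega) (by omega)
          (by omega) (by omega),
        ecast t₀ (p' := 2 ^ k) (q' := 2 ^ k - q) (by simp) (by simp) (by omega) (by omega)
          (by omega) (by omega),
        ecast t₀ (p' := 2 ^ k - p) (q' := 2 ^ k - q) (by simp) (by simp) (by omega) (by omega)
          (by omega) (by omega),
        ih t₃ hp h1 hq h2, h4]
      generalize (2 : ℤ) ^ k = n at *
      simp only [gridCount]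
      rcases le_total (p + q) n with h5 | h5 <;>
        simp (disch := omega) only [max_eq_left, max_eq_right] <;> ring
    · rw [blockCount_of_nonpos_left (x := p - 2 ^ k) (hx := by linarith [(hpk p).1 h1]),
        blockCount_of_nonpos_right (y := 2 ^ k - q) (hy := by linarith [(hkp q).1 h2]),
        blockCount_of_nonpos_right (y := 2 ^ k - q) (hy := by linarith [(hkp q).1 h2]),
        blockCount_of_ge_right (y := q) (hy := (hkp q).1 h2),
        ecast t₀ (p' := 2 ^ k - p) (q' := 2 ^ k) (by simp) (by simp) (by omega) (by omega)
          (by omega) (by omega),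
        ecast t₂ (p' := p) (q' := q - 2 ^ k) (by simp) (by simp) (by omega) (by omega)
          (by omega) (by omega),
        ecast t₃ (p' := p) (q' := 2 ^ k) (by simp) (by simp) (by omega) (by omega)
          (by omega) (by omega), h4]
      generalize (2 : ℤ) ^ k = n at *
      simp only [gridCount]
      rcases le_total (p + q) (n * 2) with h5 | h5 <;>
        simp (disch := omega) only [max_eq_left, max_eq_right] <;> ring
    · rw [blockCount_of_nonpos_right (y := q - 2 ^ k) (hy := by linarith [(hpk q).1 h2]),
        blockCount_of_nonpos_left (x := 2 ^ k - p) (hx := by linarith [(hkp p).1 h1]),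
        blockCount_of_nonpos_left (x := 2 ^ k - p) (hx := by linarith [(hkp p).1 h1]),
        blockCount_of_ge_left (x := p) (hx := (hkp p).1 h1),
        ecast t₀ (p' := 2 ^ k) (q' := 2 ^ k - q) (by simp) (by simp) (by omega) (by omega)
          (by omega) (by omega),
        ecast t₁ (p' := p - 2 ^ k) (q' := q) (by simp) (by simp) (by omega) (by omega)
          (by omega) (by omega),
        ecast t₃ (p' := 2 ^ k) (q' := q) (by simp) (by simp) (by omega) (by omega)
          (by omega) (by omega), h4]
      generalize (2 : ℤ) ^ k = n at *
      simp only [gridCount]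
      rcases le_total (p + q) (n * 2) with h5 | h5 <;>
        simp (disch := omega) only [max_eq_left, max_eq_right] <;> ring
    · rw [blockCount_of_nonpos_left (x := 2 ^ k - p) (hx := by linarith [(hkp p).1 h1]),
        blockCount_of_nonpos_left (x := 2 ^ k - p) (hx := by linarith [(hkp p).1 h1]),
        blockCount_of_nonpos_right (y := 2 ^ k - q) (hy := by linarith [(hkp q).1 h2]),
        blockCount_of_ge_right (y := q) (hy := (hkp q).1 h2),
        blockCount_of_ge_left (x := p) (hx := (hkp p).1 h1),
        blockCount_of_ge_right (y := q) (hy := (hkp q).1 h2),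
        blockCount_of_ge_left (x := p) (hx := (hkp p).1 h1),
        ecast t₁ (p' := p - 2 ^ k) (q' := 2 ^ k) (by simp) (by simp) (by omega) (by omega)
          (by omega) (by omega),
        ecast t₂ (p' := 2 ^ k) (q' := q - 2 ^ k) (by simp) (by simp) (by omega) (by omega)
          (by omega) (by omega),
        ecast t₃ (p' := 2 ^ k) (q' := 2 ^ k) (by simp) (by simp) (by omega) (by omega)
          (by omega) (by omega), h4]
      generalize (2 : ℤ) ^ k = n at *
      simp only [gridCount]
      simp (disch := omega) only [max_eq_right]
      ring

/-- The part of the standard triangle cut out by the rectangle `[0, a) × [0, b)`. -/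
def stdCorner (a b : ℝ) : Set Pt :=
  {p | 0 ≤ p.1 ∧ p.1 < a ∧ 0 ≤ p.2 ∧ p.2 < b ∧ p.1 + p.2 ≤ 1}

theorem measurableSet_stdCorner (a b : ℝ) : MeasurableSet (stdCorner a b) := by
  have h1 : Measurable fun p : Pt => p.1 := measurable_fst
  have h2 : Measurable fun p : Pt => p.2 := measurable_snd
  exact (measurableSet_le measurable_const h1).inter <|
    (measurableSet_lt h1 measurable_const).inter <|
    (measurableSet_le measurable_const h2).inter <|
    (measurableSet_lt h2 measurable_const).inter <|
    measurableSet_le (h1.add h2) measurable_const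

theorem volume_stdCorner_section (a b u : ℝ) :
    volume (Prod.mk u ⁻¹' stdCorner a b) =
      (Set.Ico 0 a).indicator (fun u => ENNReal.ofReal (min b (1 - u))) u := by
  by_cases hu : u ∈ Set.Ico 0 a
  · rw [Set.indicator_of_mem hu]
    apply le_antisymm
    · have : Prod.mk u ⁻¹' stdCorner a b ⊆ Set.Icc 0 (min b (1 - u)) := by
        rintro v ⟨-, -, h3, h4, h5⟩
        exact ⟨h3, le_min h4.le (by linarith)⟩
      simpa only [Real.volume_Icc, sub_zero] using measure_mono (μ := volume) this
    · have : Set.Ico 0 (min b (1 - u)) ⊆ Prod.mk u ⁻¹' stdCorner a b := by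
        rintro v ⟨h1, h2⟩
        have := lt_min_iff.1 h2
        exact ⟨hu.1, hu.2, h1, this.1, by dsimp only; linarith⟩
      simpa only [Real.volume_Ico, sub_zero] using measure_mono (μ := volume) this
  · rw [Set.indicator_of_notMem hu]
    have : Prod.mk u ⁻¹' stdCorner a b = ∅ :=
      Set.eq_empty_of_forall_notMem fun v h => hu ⟨h.1, h.2.1⟩
    rw [this, measure_empty]

theorem integral_min_one_sub {a b : ℝ} (ha : 0 ≤ a) (hb' : b ≤ 1) :
    ∫ u in (0 : ℝ)..a, min b (1 - u) = a * b - (max 0 (a + b - 1)) ^ 2 / 2 := by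
  have hconst (x : ℝ) (hx : 0 ≤ x) (hxb : x + b ≤ 1) : ∫ u in (0 : ℝ)..x, min b (1 - u) = x * b := by
    rw [intervalIntegral.integral_congr (g := fun _ => b)]
    · simp
    · intro u hu
      rw [Set.uIcc_of_le hx] at hu
      exact min_eq_left (by linarith [hu.2])
  rcases le_total (a + b) 1 with h | h
  · rw [hconst a ha h, max_eq_left (by linarith)]
    ring
  · have hc : Continuous fun u : ℝ => min b (1 - u) := by fun_prop
    rw [← intervalIntegral.integral_add_adjacent_intervals (b := 1 - b)
      (hc.intervalIntegrable _ _) (hc.intervalIntegrable _ _),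
      hconst (1 - b) (by linarith) (by linarith),
      intervalIntegral.integral_congr (g := fun u => 1 - u)]
    · rw [max_eq_right (by linarith), intervalIntegral.integral_sub (by simp) (by simp)]
      simp
      ring
    · intro u hu
      rw [Set.uIcc_of_le (by linarith)] at hu
      exact min_eq_right (by linarith [hu.1])

theorem vol_stdCorner {a b : ℝ} (ha : 0 ≤ a) (ha' : a ≤ 1) (hb : 0 ≤ b) (hb' : b ≤ 1) :
    vol (stdCorner a b) = a * b - (max 0 (a + b - 1)) ^ 2 / 2 := by
  have hc : Continuous fun u : ℝ => min b (1 - u) := by fun_prop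
  rw [vol, Measure.volume_eq_prod, Measure.prod_apply (measurableSet_stdCorner a b),
    lintegral_congr fun u => volume_stdCorner_section a b u, lintegral_indicator measurableSet_Ico,
    ← integral_min_one_sub ha hb', intervalIntegral.integral_of_le ha,
    ← integral_Ico_eq_integral_Ioc, integral_eq_lintegral_of_nonneg_ae]
  · filter_upwards [ae_restrict_mem measurableSet_Ico] with u hu
    have : (0 : ℝ) ≤ 1 - u := by linarith [hu.2]
    exact le_min hb this
  · exact hc.aestronglyMeasurable

/-- The standard triangle in the plane. -/
def stdTri : Set Pt := {p | 0 ≤ p.1 ∧ 0 ≤ p.2 ∧ p.1 + p.2 ≤ 1}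

theorem vol_stdTri : vol stdTri = 1 / 2 := by
  have h : stdTri = stdCorner 1 1 ∪ {((1 : ℝ), (0 : ℝ)), ((0 : ℝ), (1 : ℝ))} := by
    ext ⟨u, v⟩
    simp only [stdTri, stdCorner, Set.mem_ofPred_eq, Set.mem_union, Set.mem_insert_iff,
      Set.mem_singleton_iff, Prod.mk.injEq]
    constructor
    · rintro ⟨h1, h2, h3⟩
      rcases lt_or_ge u 1 with hu | hu
      · rcases lt_or_ge v 1 with hv | hv
        · exact Or.inl ⟨h1, hu, h2, hv, h3⟩
        · exact Or.inr (Or.inr ⟨by linarith, by linarith⟩)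
      · exact Or.inr (Or.inl ⟨by linarith, by linarith⟩)
    · rintro (⟨h1, -, h3, -, h5⟩ | ⟨rfl, rfl⟩ | ⟨rfl, rfl⟩)
      · exact ⟨h1, h3, h5⟩
      · norm_num
      · norm_num
  have h0 : volume ({((1 : ℝ), (0 : ℝ)), ((0 : ℝ), (1 : ℝ))} : Set Pt) = 0 :=
    (Set.toFinite _).measure_zero _
  rw [h, vol, measure_congr (union_ae_eq_left_of_ae_eq_empty (ae_eq_empty.2 h0)), ← vol,
    vol_stdCorner] <;> norm_num

/-- The linear map sending the standard basis to `A - C` and `B - C`. -/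
def cornerMap (A B C : Pt) : Pt →ₗ[ℝ] Pt :=
  (LinearMap.fst ℝ ℝ ℝ).smulRight (A - C) + (LinearMap.snd ℝ ℝ ℝ).smulRight (B - C)

theorem cornerMap_apply (A B C p : Pt) :
    cornerMap A B C p = p.1 • (A - C) + p.2 • (B - C) := rfl

theorem ker_cornerMap {A B C : Pt} (h : Nondeg A B C) : LinearMap.ker (cornerMap A B C) = ⊥ := by
  rw [LinearMap.ker_eq_bot']
  intro p hp
  rw [cornerMap_apply] at hp
  by_contra hne
  apply h
  rw [collinear_iff_of_mem (p₀ := C) (by simp)]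
  have hsub (X : Pt) : (1 : ℝ) • (X - C) +ᵥ C = X := by simp
  by_cases h1 : p.1 = 0
  · have h2 : p.2 ≠ 0 := fun h2 => hne (Prod.ext h1 h2)
    have hB : B - C = 0 := by
      simpa [h1, h2] using hp
    refine ⟨A - C, ?_⟩
    rintro X (rfl | rfl | rfl)
    · exact ⟨1, (hsub _).symm⟩
    · exact ⟨0, by simpa using sub_eq_zero.1 hB⟩
    · exact ⟨0, by simp⟩
  · have hA : A - C = (-(p.2 / p.1)) • (B - C) := by
      have h3 : p.1 • (A - C) = -(p.2 • (B - C)) := eq_neg_of_add_eq_zero_left hp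
      rw [← inv_smul_smul₀ h1 (A - C), h3, smul_neg, smul_smul, neg_smul]
      congr 2
      field_simp
    refine ⟨B - C, ?_⟩
    rintro X (rfl | rfl | rfl)
    · exact ⟨-(p.2 / p.1), by rw [← hA]; simp⟩
    · exact ⟨1, (hsub _).symm⟩
    · exact ⟨0, by simp⟩

/-- The affine map sending the standard triangle to the triangle `A B C`, with the right angle
sent to `C`. -/
def cornerAff (A B C p : Pt) : Pt := C + cornerMap A B C p

theorem cornerAff_injective {A B C : Pt} (h : Nondeg A B C) :
    Function.Injective (cornerAff A B C) := fun _ _ hxy =>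
  LinearMap.ker_eq_bot.1 (ker_cornerMap h) (add_left_cancel hxy)

theorem vol_image_cornerAff (A B C : Pt) (s : Set Pt) :
    vol (cornerAff A B C '' s) = |LinearMap.det (cornerMap A B C)| * vol s := by
  have : cornerAff A B C '' s = (fun x => C + x) '' (cornerMap A B C '' s) := by
    rw [Set.image_image]
    rfl
  rw [vol, this, Set.image_add_left, measure_preimage_add, Measure.addHaar_image_linearMap,
    ENNReal.toReal_mul, ENNReal.toReal_ofReal (abs_nonneg _), vol]

theorem convex_stdTri : Convex ℝ stdTri := by
  rintro ⟨x, y⟩ ⟨h1, h2, h3⟩ ⟨x', y'⟩ ⟨h1', h2', h3'⟩ a b ha hb hab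
  dsimp only at h1 h2 h3 h1' h2' h3'
  refine ⟨?_, ?_, ?_⟩ <;> simp only [Prod.smul_mk, Prod.mk_add_mk, smul_eq_mul]
  · positivity
  · positivity
  · nlinarith

theorem triangle_eq_image (A B C : Pt) : triangle A B C = cornerAff A B C '' stdTri := by
  apply Set.Subset.antisymm
  · refine convexHull_min ?_ ?_
    · rintro X (rfl | rfl | rfl)
      · exact ⟨(1, 0), by simp [stdTri], by simp [cornerAff, cornerMap_apply]⟩
      · exact ⟨(0, 1), by simp [stdTri], by simp [cornerAff, cornerMap_apply]⟩
      · exact ⟨(0, 0), by simp [stdTri], by simp [cornerAff, cornerMap_apply]⟩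
    · have : cornerAff A B C '' stdTri = (fun x => C + x) '' (cornerMap A B C '' stdTri) := by
        rw [Set.image_image]
        rfl
      rw [this]
      exact (convex_stdTri.linear_image _).translate C
  · rintro _ ⟨⟨u, v⟩, ⟨h1, h2, h3⟩, rfl⟩
    dsimp only at h1 h2 h3
    have key := (convex_convexHull ℝ ({A, B, C} : Set Pt)).sum_mem (t := Finset.univ)
      (w := ![u, v, 1 - u - v]) (z := ![A, B, C])
      (by intro i _; fin_cases i <;> simp <;> linarith)
      (by simp [Fin.sum_univ_three])
      (by intro i _; apply subset_convexHull; fin_cases i <;> simp)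
    have e : cornerAff A B C (u, v) = u • A + v • B + (1 - u - v) • C := by
      rw [cornerAff, cornerMap_apply]
      module
    rw [e]
    simpa [triangle, Fin.sum_univ_three] using key

theorem parlg_inter_triangle {A B C : Pt} (h : Nondeg A B C) (a b : ℝ) :
    parlg A B C a b ∩ triangle A B C = cornerAff A B C '' stdCorner a b := by
  have : parlg A B C a b =
      cornerAff A B C '' {p | 0 ≤ p.1 ∧ p.1 < a ∧ 0 ≤ p.2 ∧ p.2 < b} := by
    ext x
    constructor
    · rintro ⟨s, t, h1, h2, h3, h4, rfl⟩
      exact ⟨(s, t), ⟨h1, h2, h3, h4⟩, by rw [cornerAff, cornerMap_apply, add_assoc]⟩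
    · rintro ⟨⟨s, t⟩, ⟨h1, h2, h3, h4⟩, rfl⟩
      exact ⟨s, t, h1, h2, h3, h4, by rw [cornerAff, cornerMap_apply, add_assoc]⟩
  rw [this, triangle_eq_image, ← Set.image_inter (cornerAff_injective h)]
  congr 1
  ext p
  simp only [stdTri, stdCorner, Set.mem_inter_iff, Set.mem_ofPred_eq]
  tauto

theorem vol_corner_div {A B C : Pt} (h : Nondeg A B C) {a b : ℝ} (ha : 0 ≤ a) (ha' : a ≤ 1)
    (hb : 0 ≤ b) (hb' : b ≤ 1) :
    vol ((parlg A B C a b ∩ triangle A B C) ∩ triangle A B C) / vol (triangle A B C) =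
      2 * a * b - (max 0 (a + b - 1)) ^ 2 := by
  have hdet : |LinearMap.det (cornerMap A B C)| ≠ 0 := abs_ne_zero.2 fun h0 =>
    (LinearMap.bot_lt_ker_of_det_eq_zero h0).ne' (ker_cornerMap h)
  rw [Set.inter_assoc, Set.inter_self, parlg_inter_triangle h, triangle_eq_image,
    vol_image_cornerAff, vol_image_cornerAff, mul_div_mul_left _ _ hdet, vol_stdTri,
    vol_stdCorner ha ha' hb hb']
  ring

theorem card_corner {A B C : Pt} (h : Nondeg A B C) (c d k s : ℕ) (P : Fin (4 ^ k) → Pt)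
    (hsum : ∀ i, vdcCoord c i + vdcCoord d i ≤ 1)
    (hP : ∀ i, P i = cornerAff A B C (vdcCoord c (s + i), vdcCoord d (s + i))) (a b : ℝ) :
    (Nat.card {i : Fin (4 ^ k) // P i ∈ parlg A B C a b ∩ triangle A B C} : ℤ) =
      blockCount c d k s (2 ^ k * a) (2 ^ k * b) := by
  classical
  have h2 : (0 : ℝ) < 2 ^ k := by positivity
  have hmem (i : Fin (4 ^ k)) : P i ∈ parlg A B C a b ∩ triangle A B C ↔
      2 ^ k * vdcCoord c (s + i) < 2 ^ k * a ∧ 2 ^ k * vdcCoord d (s + i) < 2 ^ k * b := by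
    rw [parlg_inter_triangle h, hP, (cornerAff_injective h).mem_set_image,
      mul_lt_mul_iff_right₀ h2, mul_lt_mul_iff_right₀ h2]
    have h3 := (vdcCoord_mem_Ioo c (s + i)).1.le
    have h4 := (vdcCoord_mem_Ioo d (s + i)).1.le
    have h5 := hsum (s + i)
    simp only [stdCorner, Set.mem_ofPred_eq]
    tauto
  simp only [hmem]
  rw [Nat.card_eq_fintype_card, Fintype.card_subtype, blockCount,
    Finset.sum_range (f := fun i => if 2 ^ k * vdcCoord c (s + i) < 2 ^ k * a ∧
      2 ^ k * vdcCoord d (s + i) < 2 ^ k * b then (1 : ℤ) else 0), Finset.sum_boole]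

theorem gridArea_mono {n x x' y y' : ℝ} (hx : x ≤ x') (hx' : x' ≤ n) (hx0 : 0 ≤ x) (hy0 : 0 ≤ y)
    (hy : y ≤ y') (hy' : y' ≤ n) :
    2 * x * y - (max 0 (x + y - n)) ^ 2 ≤ 2 * x' * y' - (max 0 (x' + y' - n)) ^ 2 := by
  rcases max_cases 0 (x + y - n) with ⟨e1, h1⟩ | ⟨e1, h1⟩ <;>
    rcases max_cases 0 (x' + y' - n) with ⟨e2, h2⟩ | ⟨e2, h2⟩ <;> rw [e1, e2]
  · nlinarith
  · nlinarith [mul_nonneg (sub_nonneg.2 hx') (sub_nonneg.2 hy'), sq_nonneg (x' - y')]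
  · linarith
  · nlinarith [mul_nonneg (sub_nonneg.2 hx) (sub_nonneg.2 hy')]

theorem gridCount_succ_sub_le (n i j : ℤ) :
    gridCount n (i + 1) (j + 1) - gridCount n i j ≤ 2 * n - 1 := by
  simp only [gridCount]
  rcases max_cases 0 (i + j - n) with ⟨e1, h1⟩ | ⟨e1, h1⟩ <;>
    rcases max_cases 0 (i + 1 + (j + 1) - n) with ⟨e2, h2⟩ | ⟨e2, h2⟩ <;> rw [e1, e2]
  · nlinarith
  · obtain h | h : i + j = n ∨ i + j = n - 1 := by omega
    · obtain rfl : n = i + j := h.symm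
      ring_nf
      omega
    · obtain rfl : n = i + j + 1 := by omega
      ring_nf
      omega
  · omega
  · nlinarith

theorem abs_sdisc_corner_le {A B C : Pt} (h : Nondeg A B C) {c d : ℕ}
    (hcd : (c = 1 ∧ d = 2) ∨ (c = 2 ∧ d = 3) ∨ (c = 1 ∧ d = 3)) (k s : ℕ)
    (P : Fin (4 ^ k) → Pt)
    (hP : ∀ i, P i = cornerAff A B C (vdcCoord c (s + i), vdcCoord d (s + i)))
    {S : Set Pt} (hS : S ∈ anchoredFam A B C) :
    |sdisc S P (triangle A B C)| ≤ 2 / Real.sqrt ((4 : ℝ) ^ k) - 1 / (4 : ℝ) ^ k := by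
  obtain ⟨a, b, ha, ha', hb, hb', rfl⟩ := hS
  have hsum (i : ℕ) : vdcCoord c i + vdcCoord d i ≤ 1 := by
    have h0 := vdcCoord_sum i
    have h1 := (vdcCoord_mem_Ioo 1 i).1
    have h2 := (vdcCoord_mem_Ioo 2 i).1
    have h3 := (vdcCoord_mem_Ioo 3 i).1
    rcases hcd with ⟨rfl, rfl⟩ | ⟨rfl, rfl⟩ | ⟨rfl, rfl⟩ <;> linarith
  have hcard := card_corner h c d k s P hsum hP a b
  have hn : (0 : ℝ) < 2 ^ k := by positivity
  have h4 : (4 : ℝ) ^ k = 2 ^ k * 2 ^ k := by rw [← mul_pow]; norm_num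
  have hceil {x : ℝ} (hx : 0 < x) (hx' : x ≤ 1) : ∃ i : ℤ, 0 ≤ i ∧ i + 1 ≤ 2 ^ k ∧
      (i : ℝ) ≤ 2 ^ k * x ∧ 2 ^ k * x ≤ i + 1 := by
    refine ⟨⌈2 ^ k * x⌉ - 1, ?_, ?_, ?_, ?_⟩
    · have := Int.ceil_pos.2 (mul_pos hn hx)
      omega
    · have : ⌈2 ^ k * x⌉ ≤ (2 ^ k : ℤ) := Int.ceil_le.2 (by push_cast; nlinarith)
      omega
    · push_cast
      linarith [Int.ceil_lt_add_one ((2 : ℝ) ^ k * x)]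
    · push_cast
      linarith [Int.le_ceil ((2 : ℝ) ^ k * x)]
  obtain ⟨i, hi0, hin, hi1, hi2⟩ := hceil ha ha'
  obtain ⟨j, hj0, hjn, hj1, hj2⟩ := hceil hb hb'
  have hlow : gridCount (2 ^ k) i j ≤ blockCount c d k s (2 ^ k * a) (2 ^ k * b) := by
    rw [← blockCount_eq_gridCount hcd k s hi0 (by omega) hj0 (by omega)]
    exact blockCount_mono _ _ _ _ hi1 hj1
  have hupp : blockCount c d k s (2 ^ k * a) (2 ^ k * b) ≤ gridCount (2 ^ k) (i + 1) (j + 1) := by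
    rw [← blockCount_eq_gridCount hcd k s (by omega) hin (by omega) hjn]
    push_cast
    exact blockCount_mono _ _ _ _ hi2 hj2
  have hdiff := gridCount_succ_sub_le (2 ^ k) i j
  rw [← hcard] at hlow hupp
  rw [sdisc, vol_corner_div h ha.le ha' hb.le hb']
  generalize Nat.card {i : Fin (4 ^ k) // P i ∈ parlg A B C a b ∩ triangle A B C} = m at *
  rw [← Int.cast_le (R := ℝ)] at hlow hupp hdiff hin hjn
  simp only [gridCount] at hlow hupp hdiff
  push_cast at hlow hupp hdiff hin hjn ⊢
  rw [h4, Real.sqrt_mul_self hn.le]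
  have hi0' : (0 : ℝ) ≤ i := by exact_mod_cast hi0
  have hj0' : (0 : ℝ) ≤ j := by exact_mod_cast hj0
  have hmax : 2 ^ k * max 0 (a + b - 1) = max 0 (2 ^ k * a + 2 ^ k * b - 2 ^ k) := by
    rw [mul_max_of_nonneg _ _ hn.le]
    ring_nf
  generalize (2 : ℝ) ^ k = n at *
  have m1 := gridArea_mono (n := n) hi1 (by nlinarith) hi0' hj0' hj1 (by nlinarith)
  have m2 := gridArea_mono (n := n) hi2 hin (by positivity) (by positivity) hj2 hjn
  have harea : 2 * a * b - (max 0 (a + b - 1)) ^ 2 =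
      (2 * (n * a) * (n * b) - (max 0 (n * a + n * b - n)) ^ 2) / (n * n) := by
    rw [← hmax]
    field_simp
  have hbound : 2 / n - 1 / (n * n) = (2 * n - 1) / (n * n) := by field_simp
  rw [harea, hbound, ← sub_div, abs_div, abs_of_pos (mul_pos hn hn)]
  refine div_le_div_of_nonneg_right ?_ (mul_pos hn hn).le
  rw [abs_le]
  constructor <;> linarith

end

/-- any block of `N = 4^k` consecutive triangular van der Corput points
(starting at `s ≥ 1`) has parallelogram discrepancy at most `2/√N - 1/N`. -/
theorem parDisc_vdc_block_le (A B C : Pt) (h : Nondeg A B C) (s k : ℕ) (hs : 1 ≤ s) :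
    parDisc (fun i : Fin (4 ^ k) => vdc (A, B, C) (s + (i : ℕ))) A B C
      ≤ 2 / Real.sqrt ((4 : ℝ) ^ k) - 1 / (4 : ℝ) ^ k := by
  have hperm₁ : ({B, C, A} : Set Pt) = {A, B, C} := by
    rw [Set.pair_comm C A, Set.insert_comm]
  have hperm₂ : ({A, C, B} : Set Pt) = {A, B, C} := by rw [Set.pair_comm]
  have hbound : 0 ≤ 2 / Real.sqrt ((4 : ℝ) ^ k) - 1 / (4 : ℝ) ^ k := by
    have h1 : (1 : ℝ) ≤ 2 ^ k := one_le_pow₀ (by norm_num)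
    have h4 : (4 : ℝ) ^ k = 2 ^ k * 2 ^ k := by rw [← mul_pow]; norm_num
    rw [h4, Real.sqrt_mul_self (by positivity), sub_nonneg, div_le_div_iff₀ (by positivity)
      (by positivity)]
    nlinarith
  refine Real.iSup_le (fun S => Real.iSup_le (fun hS => ?_) hbound) hbound
  rcases hS with (hS | hS) | hS
  · have hΩ : triangle A B C = triangle B C A := by rw [triangle, triangle, hperm₁]
    rw [hΩ]
    refine abs_sdisc_corner_le (by rwa [Nondeg, hperm₁]) (c := 2) (d := 3) (by simp) k s _
      (fun i => ?_) hS
    have h0 : vdcCoord 1 (s + i) = 1 - vdcCoord 2 (s + i) - vdcCoord 3 (s + i) := by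
      linarith [vdcCoord_sum (s + i)]
    rw [vdc_eq_sum, cornerAff, cornerMap_apply, h0]
    module
  · have hΩ : triangle A B C = triangle A C B := by rw [triangle, triangle, hperm₂]
    rw [hΩ]
    refine abs_sdisc_corner_le (by rwa [Nondeg, hperm₂]) (c := 1) (d := 3) (by simp) k s _
      (fun i => ?_) hS
    have h0 : vdcCoord 2 (s + i) = 1 - vdcCoord 1 (s + i) - vdcCoord 3 (s + i) := by
      linarith [vdcCoord_sum (s + i)]
    rw [vdc_eq_sum, cornerAff, cornerMap_apply, h0]
    module
  · refine abs_sdisc_corner_le h (c := 1) (d := 2) (by simp) k s _ (fun i => ?_) hS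
    have h0 : vdcCoord 3 (s + i) = 1 - vdcCoord 1 (s + i) - vdcCoord 2 (s + i) := by
      linarith [vdcCoord_sum (s + i)]
    rw [vdc_eq_sum, cornerAff, cornerMap_apply, h0]
    module
end

section
/- Let T ⊂ ℝ² be a nondegenerate triangle, P a list of N ≥ 1 points in T, and S a subtriangle of T whose three sides are parallel to the three sides of T (S may have the same orientation as T or the inverted orientation). Then the absolute signed discrepancy of P at S satisfies |δ_N(S;P,T)| ≤ 6·D_N^P(P;T). -/
open MeasureTheory Filter Real

open Classical in
/-- The real number `1` if `p` holds and `0` otherwise. -/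
noncomputable def boolInd (p : Prop) : ℝ := if p then 1 else 0

lemma boolInd_of_not {p : Prop} (hp : ¬ p) : boolInd p = 0 := if_neg hp

lemma boolInd_nonneg (p : Prop) : 0 ≤ boolInd p := by unfold boolInd; split_ifs <;> simp

lemma boolInd_le_one (p : Prop) : boolInd p ≤ 1 := by unfold boolInd; split_ifs <;> simp

lemma measurable_boolInd {p : Pt → Prop} (hp : MeasurableSet {x | p x}) :
    Measurable fun x => boolInd (p x) := by
  classical
  unfold boolInd
  exact Measurable.ite hp measurable_const measurable_const

/-- The linear extension of `sdisc` from sets to functions. -/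
noncomputable def fdisc {N : ℕ} (P : Fin N → Pt) (Ω : Set Pt) (f : Pt → ℝ) : ℝ :=
  (∫ x in Ω, f x) / vol Ω - (∑ i, f (P i)) / N

lemma triangle_isCompact (A B C : Pt) : IsCompact (triangle A B C) :=
  Set.Finite.isCompact_convexHull ℝ (Set.toFinite _)

lemma volume_triangle_ne_top (A B C : Pt) : volume (triangle A B C) ≠ ⊤ :=
  (triangle_isCompact A B C).measure_lt_top.ne

lemma sdisc_eq_fdisc {N : ℕ} (P : Fin N → Pt) {Ω S : Set Pt} {p : Pt → Prop}
    (hP : ∀ i, P i ∈ Ω) (hp : MeasurableSet {x | p x}) (hS : ∀ x ∈ Ω, x ∈ S ↔ p x) :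
    sdisc S P Ω = fdisc P Ω fun x => boolInd (p x) := by
  classical
  have h1 : S ∩ Ω = {x | p x} ∩ Ω := by
    ext x
    simp only [Set.mem_inter_iff, Set.mem_ofPred_eq]
    exact ⟨fun h => ⟨(hS x h.2).1 h.1, h.2⟩, fun h => ⟨(hS x h.2).2 h.1, h.2⟩⟩
  have h2 : (fun x => boolInd (p x)) = Set.indicator {x | p x} (fun _ => (1 : ℝ)) := by
    ext x
    simp [boolInd, Set.indicator_apply]
  have h3 : (∫ x in Ω, boolInd (p x)) = vol (S ∩ Ω) := by
    rw [h2, integral_indicator hp, Measure.restrict_restrict hp, h1]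
    simp [vol, Measure.real]
  have h4 : (Nat.card {i : Fin N // P i ∈ S} : ℝ) = ∑ i, boolInd (p (P i)) := by
    rw [Nat.card_eq_fintype_card, Fintype.card_subtype]
    simp only [boolInd, hS _ (hP _), Finset.sum_boole]
  rw [sdisc, fdisc, h3, h4]

/-- `f` is integrable over `Ω` and has discrepancy at most `m`. -/
structure DiscLE {N : ℕ} (P : Fin N → Pt) (Ω : Set Pt) (f : Pt → ℝ) (m : ℝ) : Prop where
  integrable : IntegrableOn f Ω
  le : fdisc P Ω f ≤ m

namespace DiscLE

variable {N : ℕ} {P : Fin N → Pt} {Ω : Set Pt} {f g : Pt → ℝ} {m n : ℝ}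

lemma add (hf : DiscLE P Ω f m) (hg : DiscLE P Ω g n) :
    DiscLE P Ω (fun x => f x + g x) (m + n) := by
  refine ⟨hf.1.add hg.1, ?_⟩
  have h1 := hf.2
  have h2 := hg.2
  have h3 : fdisc P Ω (fun x => f x + g x) = fdisc P Ω f + fdisc P Ω g := by
    unfold fdisc
    rw [integral_add hf.1 hg.1, Finset.sum_add_distrib]
    ring
  linarith

lemma mul_left (hf : DiscLE P Ω f m) {c : ℝ} (hc : 0 ≤ c) :
    DiscLE P Ω (fun x => c * f x) (c * m) := by
  refine ⟨hf.1.const_mul c, ?_⟩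
  have h3 : fdisc P Ω (fun x => c * f x) = c * fdisc P Ω f := by
    unfold fdisc
    rw [integral_const_mul, ← Finset.mul_sum]
    ring
  rw [h3]
  exact mul_le_mul_of_nonneg_left hf.2 hc

lemma const (hN : 1 ≤ N) (h0 : volume Ω ≠ 0) (ht : volume Ω ≠ ⊤) (c : ℝ) :
    DiscLE P Ω (fun _ => c) 0 := by
  refine ⟨integrableOn_const ht, ?_⟩
  have hv : vol Ω ≠ 0 := ENNReal.toReal_ne_zero.2 ⟨h0, ht⟩
  have hN' : (N : ℝ) ≠ 0 := by positivity
  have : (∫ _ in Ω, c) = vol Ω * c := by simp [vol, Measure.real]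
  rw [fdisc, this]
  simp
  field_simp
  simp

lemma of_le (hg : DiscLE P Ω g m) (hP : ∀ i, P i ∈ Ω) (hle : ∀ x ∈ Ω, g x ≤ f x)
    (hae : f =ᵐ[volume.restrict Ω] g) : fdisc P Ω f ≤ m := by
  refine le_trans ?_ hg.2
  unfold fdisc
  rw [integral_congr_ae hae]
  gcongr with i
  exact hle _ (hP i)

end DiscLE

/-- `I` is measurable and, on `[0, ∞)`, is empty or a limit of intervals `[0, x)` with
`0 < x ≤ 1`. -/
def IsCut (I : Set ℝ) : Prop :=
  MeasurableSet I ∧ ((∀ t, 0 ≤ t → t ∉ I) ∨ ∃ x : ℕ → ℝ, (∀ n, 0 < x n ∧ x n ≤ 1) ∧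
    ∀ t, 0 ≤ t → ∀ᶠ n in atTop, (t < x n ↔ t ∈ I))

lemma isCut_Iio {a : ℝ} (ha : a ≤ 1) : IsCut (Set.Iio a) := by
  refine ⟨measurableSet_Iio, ?_⟩
  rcases le_or_gt a 0 with h | h
  · exact Or.inl fun t ht hta => by linarith [Set.mem_Iio.1 hta]
  · exact Or.inr ⟨fun _ => a, fun _ => ⟨h, ha⟩, fun t _ => by simp⟩

lemma isCut_Iic {a : ℝ} (ha : a < 1) : IsCut (Set.Iic a) := by
  refine ⟨measurableSet_Iic, ?_⟩
  rcases lt_or_ge a 0 with h | h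
  · exact Or.inl fun t ht hta => by linarith [Set.mem_Iic.1 hta]
  · refine Or.inr ⟨fun n => a + (1 - a) * (1 / ((n : ℝ) + 1)), fun n => ?_, fun t _ => ?_⟩
    · have h1 : 1 / ((n : ℝ) + 1) ≤ 1 := by
        rw [div_le_one (by positivity)]
        linarith [(Nat.cast_nonneg n : (0 : ℝ) ≤ n)]
      have h2 : 0 < 1 / ((n : ℝ) + 1) := by positivity
      constructor <;> nlinarith
    · have hlim : Tendsto (fun n : ℕ => a + (1 - a) * (1 / ((n : ℝ) + 1))) atTop (nhds a) := by
        simpa using (tendsto_one_div_add_atTop_nhds_zero_nat.const_mul (1 - a)).const_add a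
      rcases le_or_gt t a with hta | hta
      · refine Eventually.of_forall fun n => ?_
        have h2 : 0 < 1 / ((n : ℝ) + 1) := by positivity
        have : 0 < (1 - a) * (1 / ((n : ℝ) + 1)) := mul_pos (by linarith) h2
        simp only [Set.mem_Iic, hta, iff_true]
        linarith
      · filter_upwards [hlim.eventually_lt_const hta] with n hn
        simp only [Set.mem_Iic, not_le.2 hta, iff_false, not_lt]
        exact hn.le

lemma isCut_Iic_inter_Iio {a : ℝ} (ha : a ≤ 1) : IsCut {t | t ≤ a ∧ t < 1} := by
  rcases ha.lt_or_eq with h | rfl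
  · convert isCut_Iic h using 1
    ext t
    simp only [Set.mem_ofPred_eq, Set.mem_Iic, and_iff_left_iff_imp]
    intro ht
    linarith
  · convert isCut_Iio le_rfl using 1
    ext t
    simp only [Set.mem_ofPred_eq, Set.mem_Iio, and_iff_right_iff_imp]
    exact le_of_lt

lemma tendsto_fdisc {N : ℕ} (P : Fin N → Pt) {Ω : Set Pt} (hP : ∀ i, P i ∈ Ω)
    (hΩ : MeasurableSet Ω) (ht : volume Ω ≠ ⊤) {p : ℕ → Pt → Prop} {q : Pt → Prop}
    (hp : ∀ n, MeasurableSet {x | p n x}) (h : ∀ x ∈ Ω, ∀ᶠ n in atTop, (p n x ↔ q x)) :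
    Tendsto (fun n => fdisc P Ω fun x => boolInd (p n x)) atTop
      (nhds (fdisc P Ω fun x => boolInd (q x))) := by
  have hpt : ∀ x ∈ Ω, Tendsto (fun n => boolInd (p n x)) atTop (nhds (boolInd (q x))) := by
    intro x hx
    refine tendsto_const_nhds.congr' ?_
    filter_upwards [h x hx] with n hn
    rw [propext hn]
  refine Tendsto.sub (Tendsto.div_const ?_ _) (Tendsto.div_const ?_ _)
  · refine MeasureTheory.tendsto_integral_of_dominated_convergence (fun _ => 1)
      (fun n => (measurable_boolInd (hp n)).aestronglyMeasurable) (integrableOn_const ht)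
      (fun n => Eventually.of_forall fun x => ?_) ?_
    · rw [Real.norm_of_nonneg (boolInd_nonneg _)]
      exact boolInd_le_one _
    · filter_upwards [ae_restrict_mem hΩ] with x hx using hpt x hx
  · exact tendsto_finsetSum _ fun i _ => hpt _ (hP i)

lemma integrableOn_boolInd {Ω : Set Pt} (ht : volume Ω ≠ ⊤) {p : Pt → Prop}
    (hp : MeasurableSet {x | p x}) : IntegrableOn (fun x => boolInd (p x)) Ω := by
  refine Measure.integrableOn_of_bounded ht (measurable_boolInd hp).aestronglyMeasurable
    (M := 1) (Eventually.of_forall fun x => ?_)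
  rw [Real.norm_of_nonneg (boolInd_nonneg _)]
  exact boolInd_le_one _

/-- A discrepancy bound over half-open boxes extends to boxes whose sides are cuts. -/
lemma abs_fdisc_le_of_isCut {N : ℕ} (P : Fin N → Pt) {Ω : Set Pt} (hP : ∀ i, P i ∈ Ω)
    (hΩ : MeasurableSet Ω) (ht : volume Ω ≠ ⊤) {u v : Pt → ℝ} (hu : Measurable u)
    (hv : Measurable v) (hu0 : ∀ x ∈ Ω, 0 ≤ u x) (hv0 : ∀ x ∈ Ω, 0 ≤ v x) {D : ℝ}
    (hD : ∀ a b, 0 < a → a ≤ 1 → 0 < b → b ≤ 1 →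
      |fdisc P Ω fun x => boolInd (u x < a ∧ v x < b)| ≤ D)
    {I J : Set ℝ} (hI : IsCut I) (hJ : IsCut J) :
    |fdisc P Ω fun x => boolInd (u x ∈ I ∧ v x ∈ J)| ≤ D := by
  have hD0 : 0 ≤ D := (abs_nonneg _).trans (hD 1 1 one_pos le_rfl one_pos le_rfl)
  have hzero : (∀ x ∈ Ω, ¬ (u x ∈ I ∧ v x ∈ J)) →
      |fdisc P Ω fun x => boolInd (u x ∈ I ∧ v x ∈ J)| ≤ D := by
    intro h
    have h1 : (∫ x in Ω, boolInd (u x ∈ I ∧ v x ∈ J)) = ∫ x in Ω, (0 : ℝ) :=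
      setIntegral_congr_fun hΩ fun x hx => boolInd_of_not (h x hx)
    have h2 : ∑ i, boolInd (u (P i) ∈ I ∧ v (P i) ∈ J) = 0 :=
      Finset.sum_eq_zero fun i _ => boolInd_of_not (h _ (hP i))
    simpa [fdisc, h1, h2] using hD0
  rcases hI with ⟨-, hI | ⟨a, ha, haI⟩⟩
  · exact hzero fun x hx h => hI _ (hu0 x hx) h.1
  rcases hJ with ⟨-, hJ | ⟨b, hb, hbJ⟩⟩
  · exact hzero fun x hx h => hJ _ (hv0 x hx) h.2
  refine le_of_tendsto (tendsto_fdisc P hP hΩ ht (p := fun n x => u x < a n ∧ v x < b n)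
    (fun n => ?_) fun x hx => ?_).abs (Eventually.of_forall fun n =>
      hD _ _ (ha n).1 (ha n).2 (hb n).1 (hb n).2)
  · exact (measurableSet_lt hu measurable_const).inter (measurableSet_lt hv measurable_const)
  · filter_upwards [haI _ (hu0 x hx), hbJ _ (hv0 x hx)] with n h1 h2
    rw [h1, h2]

lemma abs_sdisc_le_one {N : ℕ} (S : Set Pt) (P : Fin N → Pt) {Ω : Set Pt}
    (ht : volume Ω ≠ ⊤) : |sdisc S P Ω| ≤ 1 := by
  have h1 : vol (S ∩ Ω) / vol Ω ≤ 1 :=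
    div_le_one_of_le₀ (ENNReal.toReal_mono ht (measure_mono Set.inter_subset_right))
      ENNReal.toReal_nonneg
  have h2 : 0 ≤ vol (S ∩ Ω) / vol Ω := div_nonneg ENNReal.toReal_nonneg ENNReal.toReal_nonneg
  have h3 : (Nat.card {i : Fin N // P i ∈ S} : ℝ) / N ≤ 1 := by
    refine div_le_one_of_le₀ ?_ (Nat.cast_nonneg _)
    exact_mod_cast (Finite.card_subtype_le fun i => P i ∈ S).trans (Nat.card_fin N).le
  have h4 : 0 ≤ (Nat.card {i : Fin N // P i ∈ S} : ℝ) / N := by positivity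
  rw [sdisc, abs_le]
  constructor <;> linarith

lemma abs_sdisc_le_disc {N : ℕ} (P : Fin N → Pt) {Ω : Set Pt} (ht : volume Ω ≠ ⊤)
    {𝒮 : Set (Set Pt)} {S : Set Pt} (hS : S ∈ 𝒮) : |sdisc S P Ω| ≤ Disc 𝒮 P Ω := by
  have hb : ∀ S' : Set Pt, (⨆ _ : S' ∈ 𝒮, |sdisc S' P Ω|) ≤ 1 := fun S' =>
    Real.iSup_le (fun _ => abs_sdisc_le_one S' P ht) zero_le_one
  have h1 : (⨆ _ : S ∈ 𝒮, |sdisc S P Ω|) = |sdisc S P Ω| := ciSup_pos hS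
  rw [← h1]
  exact le_ciSup (f := fun S' => ⨆ _ : S' ∈ 𝒮, |sdisc S' P Ω|)
    ⟨1, by rintro _ ⟨S', rfl⟩; exact hb S'⟩ S

/-- Barycentric coordinates of a nondegenerate triangle. -/
structure IsBary (A B C : Pt) (u v w : Pt →ᵃ[ℝ] ℝ) : Prop where
  sum : ∀ x, u x + v x + w x = 1
  left : u A = 1 ∧ v A = 0 ∧ w A = 0
  middle : u B = 0 ∧ v B = 1 ∧ w B = 0
  right : u C = 0 ∧ v C = 0 ∧ w C = 1
  comb : ∀ x, u x • A + v x • B + w x • C = x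
  mem_iff : ∀ x, x ∈ triangle A B C ↔ 0 ≤ u x ∧ 0 ≤ v x ∧ 0 ≤ w x
  volume_ne_zero : volume (triangle A B C) ≠ 0

lemma Nondeg.exists_isBary {A B C : Pt} (h : Nondeg A B C) :
    ∃ u v w : Pt →ᵃ[ℝ] ℝ, IsBary A B C u v w := by
  have hi : AffineIndependent ℝ ![A, B, C] := affineIndependent_iff_not_collinear_set.2 h
  have hs : affineSpan ℝ (Set.range ![A, B, C]) = ⊤ :=
    hi.affineSpan_eq_top_iff_card_eq_finrank_add_one.2 (by simp)
  let b : AffineBasis (Fin 3) ℝ Pt := ⟨![A, B, C], hi, hs⟩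
  have hA : b 0 = A := rfl
  have hB : b 1 = B := rfl
  have hC : b 2 = C := rfl
  have hT : triangle A B C = convexHull ℝ (Set.range b) := by
    have : Set.range b = {A, B, C} := by
      ext x
      simp [Fin.exists_fin_succ, hA, hB, hC, eq_comm]
    rw [this, triangle]
  refine ⟨b.coord 0, b.coord 1, b.coord 2, ?_, ?_, ?_, ?_, ?_, ?_, ?_⟩
  · intro x
    have := b.sum_coord_apply_eq_one x
    rwa [Fin.sum_univ_three] at this
  · rw [← hA]; simp [b.coord_apply]
  · rw [← hB]; simp [b.coord_apply]
  · rw [← hC]; simp [b.coord_apply]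
  · intro x
    have := b.linear_combination_coord_eq_self x
    rwa [Fin.sum_univ_three, hA, hB, hC] at this
  · intro x
    rw [hT, b.convexHull_eq_nonneg_coord]
    simp [Fin.forall_fin_succ]
  · rw [hT]
    have := b.centroid_mem_interior_convexHull
    exact (Measure.measure_pos_of_mem_nhds volume (mem_interior_iff_mem_nhds.1 this)).ne'

lemma AffineMap.apply_add_smul_sub (u : Pt →ᵃ[ℝ] ℝ) (p x y : Pt) (r : ℝ) :
    u (p + r • x) = r * (u x - u y) + u (p + r • y) := by
  have h : ∀ x, u x = u.linear x + u 0 := congrFun u.decomp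
  rw [h (p + r • x), h x, h y, h (p + r • y)]
  simp only [map_add, map_smul, smul_eq_mul]
  ring

lemma triangle_rotate (A B C : Pt) : triangle B C A = triangle A B C := by
  have : ({B, C, A} : Set Pt) = {A, B, C} := by
    ext
    simp only [Set.mem_insert_iff, Set.mem_singleton_iff]
    tauto
  rw [triangle, this, triangle]

lemma triangle_swap (A B C : Pt) : triangle A C B = triangle A B C := by
  rw [triangle, Set.pair_comm, triangle]

namespace IsBary

variable {A B C : Pt} {u v w : Pt →ᵃ[ℝ] ℝ}

lemma rotate (h : IsBary A B C u v w) : IsBary B C A v w u where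
  sum x := by linarith [h.sum x]
  left := ⟨h.middle.2.1, h.middle.2.2, h.middle.1⟩
  middle := ⟨h.right.2.1, h.right.2.2, h.right.1⟩
  right := ⟨h.left.2.1, h.left.2.2, h.left.1⟩
  comb x := by
    conv_rhs => rw [← h.comb x]
    abel
  mem_iff x := by rw [triangle_rotate, h.mem_iff]; tauto
  volume_ne_zero := by rw [triangle_rotate]; exact h.volume_ne_zero

lemma swap (h : IsBary A B C u v w) : IsBary A C B u w v where
  sum x := by linarith [h.sum x]
  left := ⟨h.left.1, h.left.2.2, h.left.2.1⟩
  middle := ⟨h.right.1, h.right.2.2, h.right.2.1⟩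
  right := ⟨h.middle.1, h.middle.2.2, h.middle.2.1⟩
  comb x := by
    conv_rhs => rw [← h.comb x]
    abel
  mem_iff x := by rw [triangle_swap, h.mem_iff]; tauto
  volume_ne_zero := by rw [triangle_swap]; exact h.volume_ne_zero

lemma mem_parlg_iff (h : IsBary A B C u v w) {a b : ℝ} {x : Pt} (hx : x ∈ triangle A B C) :
    x ∈ parlg A B C a b ↔ u x < a ∧ v x < b := by
  constructor
  · rintro ⟨s, t, -, hs, -, ht, rfl⟩
    have key : ∀ f : Pt →ᵃ[ℝ] ℝ, f (C + s • (A - C) + t • (B - C))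
        = f C + s * (f A - f C) + t * (f B - f C) := by
      intro f
      have h' : ∀ x, f x = f.linear x + f 0 := congrFun f.decomp
      rw [h' (_ + _), h' A, h' B, h' C]
      simp only [map_add, map_sub, map_smul, smul_eq_mul]
      ring
    rw [key, key, h.left.1, h.left.2.1, h.middle.1, h.middle.2.1, h.right.1, h.right.2.1]
    constructor <;> linarith
  · rintro ⟨hu, hv⟩
    obtain ⟨h1, h2, -⟩ := (h.mem_iff x).1 hx
    refine ⟨u x, v x, h1, hu, h2, hv, ?_⟩
    have hw : w x = 1 - u x - v x := by linarith [h.sum x]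
    conv_lhs => rw [← h.comb x, hw]
    module

lemma abs_fdisc_le (h : IsBary A B C u v w) {N : ℕ} {P : Fin N → Pt}
    (hP : ∀ i, P i ∈ triangle A B C) {𝒮 : Set (Set Pt)} (hS : anchoredFam A B C ⊆ 𝒮)
    {I J : Set ℝ} (hI : IsCut I) (hJ : IsCut J) :
    |fdisc P (triangle A B C) fun x => boolInd (u x ∈ I ∧ v x ∈ J)|
      ≤ Disc 𝒮 P (triangle A B C) := by
  have hu : Measurable u := u.continuous_of_finiteDimensional.measurable
  have hv : Measurable v := v.continuous_of_finiteDimensional.measurable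
  have ht := volume_triangle_ne_top A B C
  refine abs_fdisc_le_of_isCut P hP (triangle_isCompact A B C).measurableSet ht hu hv
    (fun x hx => ((h.mem_iff x).1 hx).1) (fun x hx => ((h.mem_iff x).1 hx).2.1)
    (fun a b ha ha1 hb hb1 => ?_) hI hJ
  rw [← sdisc_eq_fdisc (S := parlg A B C a b ∩ triangle A B C)
    (p := fun x => u x < a ∧ v x < b) P hP
    ((measurableSet_lt hu measurable_const).inter (measurableSet_lt hv measurable_const))
    fun x hx => by rw [Set.mem_inter_iff, h.mem_parlg_iff hx]; tauto]
  exact abs_sdisc_le_disc P ht (hS ⟨a, b, ha, ha1, hb, hb1, rfl⟩)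

lemma abs_fdisc_le_parDisc (h : IsBary A B C u v w) {N : ℕ} {P : Fin N → Pt}
    (hP : ∀ i, P i ∈ triangle A B C) {I J : Set ℝ} (hI : IsCut I) (hJ : IsCut J) :
    |fdisc P (triangle A B C) fun x => boolInd (u x ∈ I ∧ v x ∈ J)| ≤ parDisc P A B C ∧
    |fdisc P (triangle A B C) fun x => boolInd (v x ∈ I ∧ w x ∈ J)| ≤ parDisc P A B C ∧
    |fdisc P (triangle A B C) fun x => boolInd (u x ∈ I ∧ w x ∈ J)| ≤ parDisc P A B C := by
  refine ⟨h.abs_fdisc_le hP Set.subset_union_right hI hJ, ?_, ?_⟩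
  · have := h.rotate.abs_fdisc_le (P := P) (by simpa only [triangle_rotate] using hP)
      (𝒮 := parFam A B C) (Set.subset_union_left.trans Set.subset_union_left) hI hJ
    rwa [triangle_rotate] at this
  · have := h.swap.abs_fdisc_le (P := P) (by simpa only [triangle_swap] using hP)
      (𝒮 := parFam A B C) (Set.subset_union_right.trans Set.subset_union_left) hI hJ
    rwa [triangle_swap] at this

lemma mem_homothetic_iff (h : IsBary A B C u v w) (p : Pt) {r : ℝ} (hr : r ≠ 0) (x : Pt) :
    x ∈ triangle (p + r • A) (p + r • B) (p + r • C) ↔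
      0 ≤ (u x - u (p + r • B)) / r ∧ 0 ≤ (v x - v (p + r • C)) / r ∧
        0 ≤ (w x - w (p + r • A)) / r := by
  let f : Pt →ᵃ[ℝ] Pt := AffineMap.const ℝ Pt p + r • AffineMap.id ℝ Pt
  have hf : ∀ y, f y = p + r • y := fun y => by simp [f]
  have himg : triangle (p + r • A) (p + r • B) (p + r • C) = f '' triangle A B C := by
    rw [triangle, triangle, AffineMap.image_convexHull]
    simp [Set.image_insert_eq, hf]
  have hx : x = p + r • (r⁻¹ • (x - p)) := by rw [smul_inv_smul₀ hr]; abel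
  have hmem : x ∈ f '' triangle A B C ↔ r⁻¹ • (x - p) ∈ triangle A B C := by
    constructor
    · rintro ⟨y, hy, rfl⟩
      simpa [hf, inv_smul_smul₀ hr] using hy
    · intro hy
      exact ⟨_, hy, by rw [hf, ← hx]⟩
  rw [himg, hmem, h.mem_iff]
  generalize r⁻¹ • (x - p) = y at hx
  subst hx
  rw [u.apply_add_smul_sub p y B, v.apply_add_smul_sub p y C, w.apply_add_smul_sub p y A,
    h.left.2.2, h.middle.1, h.right.2.1]
  simp [hr]

end IsBary

/-- A combination of indicators of products of cuts, with total weight `6`. -/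
noncomputable def upperComb (I₁ I₂ I₃ J₁ J₂ J₃ : Set ℝ) (s t z : ℝ) : ℝ :=
  (boolInd (s ∈ I₁ ∧ t ∈ I₂) + boolInd (t ∈ I₂ ∧ z ∈ I₃) + boolInd (s ∈ I₁ ∧ z ∈ I₃)
    + boolInd (s ∈ J₁ ∧ t ∈ Set.Iio 1) + boolInd (t ∈ J₂ ∧ z ∈ Set.Iio 1)
    + boolInd (s ∈ Set.Iio 1 ∧ z ∈ J₃)
    - boolInd (s ∈ I₁ ∧ t ∈ J₂) - boolInd (s ∈ J₁ ∧ t ∈ I₂)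
    - boolInd (t ∈ I₂ ∧ z ∈ J₃) - boolInd (t ∈ J₂ ∧ z ∈ I₃)
    - boolInd (s ∈ I₁ ∧ z ∈ J₃) - boolInd (s ∈ J₁ ∧ z ∈ I₃) - 1) / 2

/-- A combination of indicators of products of cuts, with total weight `6`. -/
noncomputable def lowerComb (I₁ I₂ I₃ : Set ℝ) (s t z : ℝ) : ℝ :=
  boolInd (s ∈ I₁ ∧ t ∈ Set.Iio 1) + boolInd (t ∈ I₂ ∧ z ∈ Set.Iio 1)
    + boolInd (s ∈ Set.Iio 1 ∧ z ∈ I₃)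
    - boolInd (s ∈ I₁ ∧ t ∈ I₂) - boolInd (t ∈ I₂ ∧ z ∈ I₃) - boolInd (s ∈ I₁ ∧ z ∈ I₃) - 1

section Pointwise

variable {a b c r s t z : ℝ}

lemma upperComb_eq_of_pos (hr : 0 < r) (hsum : a + b + c + r = 1) (hst : s + t + z = 1)
    (hs : s < 1) (ht : t < 1) (hz : z < 1) :
    upperComb (Set.Iio a) (Set.Iio b) (Set.Iio c) {x | x ≤ a + r ∧ x < 1}
      {x | x ≤ b + r ∧ x < 1} {x | x ≤ c + r ∧ x < 1} s t z
      = boolInd (a ≤ s ∧ b ≤ t ∧ c ≤ z) := by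
  simp only [upperComb, boolInd, Set.mem_Iio, Set.mem_ofPred_eq]
  rcases lt_or_ge s a with x1 | x1 <;> rcases lt_or_ge t b with x2 | x2 <;>
  rcases lt_or_ge z c with x3 | x3 <;> rcases le_or_gt s (a + r) with y1 | y1 <;>
  rcases le_or_gt t (b + r) with y2 | y2 <;> rcases le_or_gt z (c + r) with y3 | y3 <;>
  first
  | (exfalso; linarith)
  | (simp only [*, not_lt.2, not_le.2, and_true, and_false, if_true, if_false]; norm_num)

lemma upperComb_eq_of_neg (hr : r < 0) (hsum : a + b + c + r = 1) (hst : s + t + z = 1)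
    (hs : s < 1) (ht : t < 1) (hz : z < 1) :
    upperComb (Set.Iic a) (Set.Iic b) (Set.Iic c) (Set.Iio (a + r)) (Set.Iio (b + r))
      (Set.Iio (c + r)) s t z = boolInd (s ≤ a ∧ t ≤ b ∧ z ≤ c) := by
  simp only [upperComb, boolInd, Set.mem_Iio, Set.mem_Iic]
  rcases le_or_gt s a with x1 | x1 <;> rcases le_or_gt t b with x2 | x2 <;>
  rcases le_or_gt z c with x3 | x3 <;> rcases lt_or_ge s (a + r) with y1 | y1 <;>
  rcases lt_or_ge t (b + r) with y2 | y2 <;> rcases lt_or_ge z (c + r) with y3 | y3 <;>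
  first
  | (exfalso; linarith)
  | (simp only [*, not_lt.2, not_le.2, and_true, and_false, if_true, if_false]; norm_num)

lemma lowerComb_eq_of_pos (hr : 0 < r) (hsum : a + b + c + r = 1) (hst : s + t + z = 1)
    (hs : s < 1) (ht : t < 1) (hz : z < 1) :
    lowerComb (Set.Iio a) (Set.Iio b) (Set.Iio c) s t z
      = -boolInd (a ≤ s ∧ b ≤ t ∧ c ≤ z) := by
  simp only [lowerComb, boolInd, Set.mem_Iio]
  rcases lt_or_ge s a with x1 | x1 <;> rcases lt_or_ge t b with x2 | x2 <;>
  rcases lt_or_ge z c with x3 | x3 <;>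
  first
  | (exfalso; linarith)
  | (simp only [*, not_lt.2, not_le.2, and_true, and_false, if_true, if_false]; norm_num)

lemma lowerComb_eq_of_neg (hr : r < 0) (hsum : a + b + c + r = 1) (hst : s + t + z = 1)
    (hs : s < 1) (ht : t < 1) (hz : z < 1) :
    lowerComb (Set.Iic a) (Set.Iic b) (Set.Iic c) s t z
      = -boolInd (s ≤ a ∧ t ≤ b ∧ z ≤ c) := by
  simp only [lowerComb, boolInd, Set.mem_Iio, Set.mem_Iic]
  rcases le_or_gt s a with x1 | x1 <;> rcases le_or_gt t b with x2 | x2 <;>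
  rcases le_or_gt z c with x3 | x3 <;>
  first
  | (exfalso; linarith)
  | (simp only [*, not_le.2, and_true, and_false, if_true, if_false]; norm_num)

/-- On the standard simplex, an inequality need only be checked at the vertices and at points
all of whose coordinates are less than `1`. -/
lemma le_of_le_vertices {F G : ℝ → ℝ → ℝ → ℝ} (hs : 0 ≤ s) (ht : 0 ≤ t) (hz : 0 ≤ z)
    (hst : s + t + z = 1) (h : s < 1 → t < 1 → z < 1 → F s t z = G s t z)
    (h₁ : G 1 0 0 ≤ F 1 0 0) (h₂ : G 0 1 0 ≤ F 0 1 0) (h₃ : G 0 0 1 ≤ F 0 0 1) :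
    G s t z ≤ F s t z := by
  rcases lt_or_ge s 1 with hs1 | hs1
  · rcases lt_or_ge t 1 with ht1 | ht1
    · rcases lt_or_ge z 1 with hz1 | hz1
      · exact (h hs1 ht1 hz1).ge
      · obtain rfl : s = 0 := by linarith
        obtain rfl : t = 0 := by linarith
        obtain rfl : z = 1 := by linarith
        exact h₃
    · obtain rfl : s = 0 := by linarith
      obtain rfl : z = 0 := by linarith
      obtain rfl : t = 1 := by linarith
      exact h₂
  · obtain rfl : t = 0 := by linarith
    obtain rfl : z = 0 := by linarith
    obtain rfl : s = 1 := by linarith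
    exact h₁

lemma upperComb_vertex_of_pos (ha : 0 ≤ a) (hb : 0 ≤ b) (hc : 0 ≤ c) (hr : 0 < r)
    (hsum : a + b + c + r = 1) :
    let G := upperComb (Set.Iio a) (Set.Iio b) (Set.Iio c) {x | x ≤ a + r ∧ x < 1}
      {x | x ≤ b + r ∧ x < 1} {x | x ≤ c + r ∧ x < 1}
    G 1 0 0 ≤ 0 ∧ G 0 1 0 ≤ 0 ∧ G 0 0 1 ≤ 0 := by
  have h1 : ¬ 1 < a := by linarith
  have h2 : ¬ 1 < b := by linarith
  have h3 : ¬ 1 < c := by linarith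
  have h4 : 0 ≤ a + r := by linarith
  have h5 : 0 ≤ b + r := by linarith
  have h6 : 0 ≤ c + r := by linarith
  simp only [upperComb, boolInd, Set.mem_Iio, Set.mem_ofPred_eq, h1, h2, h3, h4, h5, h6,
    lt_irrefl, zero_lt_one, true_and, and_true, and_false, false_and, if_true, if_false]
  refine ⟨?_, ?_, ?_⟩ <;> split_ifs <;> first | (exfalso; grind) | norm_num

lemma upperComb_vertex_of_neg (ha : 0 ≤ a + r) (hb : 0 ≤ b + r) (hc : 0 ≤ c + r) (hr : r < 0)
    (hsum : a + b + c + r = 1) :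
    let G := upperComb (Set.Iic a) (Set.Iic b) (Set.Iic c) (Set.Iio (a + r)) (Set.Iio (b + r))
      (Set.Iio (c + r))
    G 1 0 0 ≤ 0 ∧ G 0 1 0 ≤ 0 ∧ G 0 0 1 ≤ 0 := by
  have h1 : ¬ 1 ≤ a := by linarith
  have h2 : ¬ 1 ≤ b := by linarith
  have h3 : ¬ 1 ≤ c := by linarith
  have h4 : 0 ≤ a := by linarith
  have h5 : 0 ≤ b := by linarith
  have h6 : 0 ≤ c := by linarith
  have h7 : ¬ 1 < a + r := by linarith
  have h8 : ¬ 1 < b + r := by linarith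
  have h9 : ¬ 1 < c + r := by linarith
  simp only [upperComb, boolInd, Set.mem_Iio, Set.mem_Iic, h1, h2, h3, h4, h5, h6, h7, h8, h9,
    lt_irrefl, zero_lt_one, true_and, and_true, and_false, false_and, if_true, if_false]
  refine ⟨?_, ?_, ?_⟩ <;> split_ifs <;> norm_num

lemma lowerComb_vertex_of_pos (ha : 0 ≤ a) (hb : 0 ≤ b) (hc : 0 ≤ c) (hr : 0 < r)
    (hsum : a + b + c + r = 1) :
    let G := lowerComb (Set.Iio a) (Set.Iio b) (Set.Iio c)
    let F := fun s t z => -boolInd (a ≤ s ∧ b ≤ t ∧ c ≤ z)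
    G 1 0 0 ≤ F 1 0 0 ∧ G 0 1 0 ≤ F 0 1 0 ∧ G 0 0 1 ≤ F 0 0 1 := by
  have h1 : ¬ 1 < a := by linarith
  have h2 : ¬ 1 < b := by linarith
  have h3 : ¬ 1 < c := by linarith
  simp only [lowerComb, boolInd, Set.mem_Iio, h1, h2, h3,
    lt_irrefl, zero_lt_one, true_and, and_true, and_false, false_and, if_false]
  refine ⟨?_, ?_, ?_⟩ <;> split_ifs <;> first | (exfalso; grind) | norm_num

lemma lowerComb_vertex_of_neg (ha : 0 ≤ a + r) (hb : 0 ≤ b + r) (hc : 0 ≤ c + r) (hr : r < 0)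
    (hsum : a + b + c + r = 1) :
    let G := lowerComb (Set.Iic a) (Set.Iic b) (Set.Iic c)
    let F := fun s t z => -boolInd (s ≤ a ∧ t ≤ b ∧ z ≤ c)
    G 1 0 0 ≤ F 1 0 0 ∧ G 0 1 0 ≤ F 0 1 0 ∧ G 0 0 1 ≤ F 0 0 1 := by
  have h1 : ¬ 1 ≤ a := by linarith
  have h2 : ¬ 1 ≤ b := by linarith
  have h3 : ¬ 1 ≤ c := by linarith
  have h4 : 0 ≤ a := by linarith
  have h5 : 0 ≤ b := by linarith
  have h6 : 0 ≤ c := by linarith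
  simp only [lowerComb, boolInd, Set.mem_Iio, Set.mem_Iic, h1, h2, h3, h4, h5, h6,
    lt_irrefl, zero_lt_one, and_true, and_false, if_true, if_false]
  norm_num

end Pointwise

lemma fdisc_neg {N : ℕ} (P : Fin N → Pt) (Ω : Set Pt) (f : Pt → ℝ) :
    fdisc P Ω (fun x => -f x) = -fdisc P Ω f := by
  simp only [fdisc, integral_neg, Finset.sum_neg_distrib]
  ring

lemma DiscLE.boolInd_of_abs {N : ℕ} {P : Fin N → Pt} {Ω : Set Pt} (ht : volume Ω ≠ ⊤)
    {p : Pt → Prop} (hp : MeasurableSet {x | p x}) {D : ℝ}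
    (h : |fdisc P Ω fun x => boolInd (p x)| ≤ D) :
    DiscLE P Ω (fun x => boolInd (p x)) D ∧ DiscLE P Ω (fun x => -boolInd (p x)) D := by
  have hi := integrableOn_boolInd ht hp
  exact ⟨⟨hi, (abs_le.1 h).2⟩, ⟨hi.neg, by rw [fdisc_neg]; linarith [(abs_le.1 h).1]⟩⟩

namespace IsBary

variable {A B C : Pt} {u v w : Pt →ᵃ[ℝ] ℝ} {N : ℕ} {P : Fin N → Pt}

lemma ae_lt_one (h : IsBary A B C u v w) :
    ∀ᵐ x ∂volume.restrict (triangle A B C),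
      x ∈ triangle A B C ∧ u x < 1 ∧ v x < 1 ∧ w x < 1 := by
  have hfin : ∀ᵐ x ∂(volume : Measure Pt), x ∉ ({A, B, C} : Set Pt) :=
    measure_eq_zero_iff_ae_notMem.1 (Set.Finite.measure_zero (Set.toFinite _) _)
  filter_upwards [ae_restrict_mem (triangle_isCompact A B C).measurableSet,
    ae_restrict_of_ae hfin] with x hx hn
  obtain ⟨h1, h2, h3⟩ := (h.mem_iff x).1 hx
  have hs := h.sum x
  have hc := h.comb x
  simp only [Set.mem_insert_iff, Set.mem_singleton_iff, not_or] at hn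
  refine ⟨hx, ?_, ?_, ?_⟩ <;> by_contra! hge
  · rw [show u x = 1 by linarith, show v x = 0 by linarith, show w x = 0 by linarith] at hc
    exact hn.1 (by simpa using hc.symm)
  · rw [show u x = 0 by linarith, show v x = 1 by linarith, show w x = 0 by linarith] at hc
    exact hn.2.1 (by simpa using hc.symm)
  · rw [show u x = 0 by linarith, show v x = 0 by linarith, show w x = 1 by linarith] at hc
    exact hn.2.2 (by simpa using hc.symm)

lemma fdisc_le_of_pointwise (h : IsBary A B C u v w) (hP : ∀ i, P i ∈ triangle A B C)
    {F G : ℝ → ℝ → ℝ → ℝ} {m : ℝ}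
    (hG : DiscLE P (triangle A B C) (fun x => G (u x) (v x) (w x)) m)
    (heq : ∀ s t z, s + t + z = 1 → s < 1 → t < 1 → z < 1 → F s t z = G s t z)
    (hle : G 1 0 0 ≤ F 1 0 0 ∧ G 0 1 0 ≤ F 0 1 0 ∧ G 0 0 1 ≤ F 0 0 1) :
    fdisc P (triangle A B C) (fun x => F (u x) (v x) (w x)) ≤ m := by
  refine hG.of_le hP (fun x hx => ?_) ?_
  · obtain ⟨h1, h2, h3⟩ := (h.mem_iff x).1 hx
    exact le_of_le_vertices h1 h2 h3 (h.sum x) (heq _ _ _ (h.sum x)) hle.1 hle.2.1 hle.2.2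
  · filter_upwards [h.ae_lt_one] with x ⟨_, hu, hv, hw⟩
    exact heq _ _ _ (h.sum x) hu hv hw

lemma discLE (h : IsBary A B C u v w) (hP : ∀ i, P i ∈ triangle A B C) {I J : Set ℝ}
    (hI : IsCut I) (hJ : IsCut J) :
    (DiscLE P (triangle A B C) (fun x => boolInd (u x ∈ I ∧ v x ∈ J)) (parDisc P A B C) ∧
      DiscLE P (triangle A B C) (fun x => -boolInd (u x ∈ I ∧ v x ∈ J)) (parDisc P A B C)) ∧
    (DiscLE P (triangle A B C) (fun x => boolInd (v x ∈ I ∧ w x ∈ J)) (parDisc P A B C) ∧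
      DiscLE P (triangle A B C) (fun x => -boolInd (v x ∈ I ∧ w x ∈ J)) (parDisc P A B C)) ∧
    (DiscLE P (triangle A B C) (fun x => boolInd (u x ∈ I ∧ w x ∈ J)) (parDisc P A B C) ∧
      DiscLE P (triangle A B C) (fun x => -boolInd (u x ∈ I ∧ w x ∈ J)) (parDisc P A B C)) := by
  have hu : Measurable u := u.continuous_of_finiteDimensional.measurable
  have hv : Measurable v := v.continuous_of_finiteDimensional.measurable
  have hw : Measurable w := w.continuous_of_finiteDimensional.measurable
  have ht := volume_triangle_ne_top A B C
  obtain ⟨h1, h2, h3⟩ := h.abs_fdisc_le_parDisc hP hI hJ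
  exact ⟨DiscLE.boolInd_of_abs ht ((hu hI.1).inter (hv hJ.1)) h1,
    DiscLE.boolInd_of_abs ht ((hv hI.1).inter (hw hJ.1)) h2,
    DiscLE.boolInd_of_abs ht ((hu hI.1).inter (hw hJ.1)) h3⟩

lemma discLE_upper (h : IsBary A B C u v w) (hN : 1 ≤ N) (hP : ∀ i, P i ∈ triangle A B C)
    {I₁ I₂ I₃ J₁ J₂ J₃ : Set ℝ} (hI₁ : IsCut I₁) (hI₂ : IsCut I₂) (hI₃ : IsCut I₃)
    (hJ₁ : IsCut J₁) (hJ₂ : IsCut J₂) (hJ₃ : IsCut J₃) :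
    DiscLE P (triangle A B C) (fun x => upperComb I₁ I₂ I₃ J₁ J₂ J₃ (u x) (v x) (w x))
      (6 * parDisc P A B C) := by
  have hK : IsCut (Set.Iio (1 : ℝ)) := isCut_Iio le_rfl
  have key := (((((((((((((h.discLE hP hI₁ hI₂).1.1.add (h.discLE hP hI₂ hI₃).2.1.1).add
    (h.discLE hP hI₁ hI₃).2.2.1).add (h.discLE hP hJ₁ hK).1.1).add
    (h.discLE hP hJ₂ hK).2.1.1).add (h.discLE hP hK hJ₃).2.2.1).add
    (h.discLE hP hI₁ hJ₂).1.2).add (h.discLE hP hJ₁ hI₂).1.2).add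
    (h.discLE hP hI₂ hJ₃).2.1.2).add (h.discLE hP hJ₂ hI₃).2.1.2).add
    (h.discLE hP hI₁ hJ₃).2.2.2).add (h.discLE hP hJ₁ hI₃).2.2.2).add
    (.const hN h.volume_ne_zero (volume_triangle_ne_top A B C) (-1))).mul_left
    (by norm_num : (0 : ℝ) ≤ 1 / 2)
  convert key using 1
  · funext x
    simp only [upperComb]
    ring
  · ring

lemma discLE_lower (h : IsBary A B C u v w) (hN : 1 ≤ N) (hP : ∀ i, P i ∈ triangle A B C)
    {I₁ I₂ I₃ : Set ℝ} (hI₁ : IsCut I₁) (hI₂ : IsCut I₂) (hI₃ : IsCut I₃) :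
    DiscLE P (triangle A B C) (fun x => lowerComb I₁ I₂ I₃ (u x) (v x) (w x))
      (6 * parDisc P A B C) := by
  have hK : IsCut (Set.Iio (1 : ℝ)) := isCut_Iio le_rfl
  have key := ((((((h.discLE hP hI₁ hK).1.1.add (h.discLE hP hI₂ hK).2.1.1).add
    (h.discLE hP hK hI₃).2.2.1).add (h.discLE hP hI₁ hI₂).1.2).add
    (h.discLE hP hI₂ hI₃).2.1.2).add (h.discLE hP hI₁ hI₃).2.2.2).add
    (.const hN h.volume_ne_zero (volume_triangle_ne_top A B C) (-1))
  convert key using 1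
  · funext x
    simp only [lowerComb]
    ring
  · ring

/-- If the indicator of `S` and its negative agree away from the vertices with `upperComb` and
`lowerComb`, and dominate them at the vertices, then `S` has discrepancy at most `6 * parDisc`. -/
lemma abs_sdisc_le (h : IsBary A B C u v w) (hN : 1 ≤ N) (hP : ∀ i, P i ∈ triangle A B C)
    {S : Set Pt} {q : ℝ → ℝ → ℝ → Prop} (hq : MeasurableSet {x | q (u x) (v x) (w x)})
    (hS : ∀ x, x ∈ S ↔ q (u x) (v x) (w x)) {I₁ I₂ I₃ J₁ J₂ J₃ : Set ℝ} (hI₁ : IsCut I₁)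
    (hI₂ : IsCut I₂) (hI₃ : IsCut I₃) (hJ₁ : IsCut J₁) (hJ₂ : IsCut J₂) (hJ₃ : IsCut J₃)
    (hupper : ∀ s t z, s + t + z = 1 → s < 1 → t < 1 → z < 1 →
      upperComb I₁ I₂ I₃ J₁ J₂ J₃ s t z = boolInd (q s t z))
    (hlower : ∀ s t z, s + t + z = 1 → s < 1 → t < 1 → z < 1 →
      lowerComb I₁ I₂ I₃ s t z = -boolInd (q s t z))
    (hupper' : upperComb I₁ I₂ I₃ J₁ J₂ J₃ 1 0 0 ≤ 0 ∧ upperComb I₁ I₂ I₃ J₁ J₂ J₃ 0 1 0 ≤ 0 ∧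
      upperComb I₁ I₂ I₃ J₁ J₂ J₃ 0 0 1 ≤ 0)
    (hlower' : lowerComb I₁ I₂ I₃ 1 0 0 ≤ -boolInd (q 1 0 0) ∧
      lowerComb I₁ I₂ I₃ 0 1 0 ≤ -boolInd (q 0 1 0) ∧
      lowerComb I₁ I₂ I₃ 0 0 1 ≤ -boolInd (q 0 0 1)) :
    |sdisc S P (triangle A B C)| ≤ 6 * parDisc P A B C := by
  have h1 := h.fdisc_le_of_pointwise hP (F := fun s t z => boolInd (q s t z))
    (h.discLE_upper hN hP hI₁ hI₂ hI₃ hJ₁ hJ₂ hJ₃)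
    (fun s t z => (hupper s t z · · · · |>.symm))
    ⟨hupper'.1.trans (boolInd_nonneg _), hupper'.2.1.trans (boolInd_nonneg _),
      hupper'.2.2.trans (boolInd_nonneg _)⟩
  have h2 := h.fdisc_le_of_pointwise hP (F := fun s t z => -boolInd (q s t z))
    (h.discLE_lower hN hP hI₁ hI₂ hI₃) (fun s t z => (hlower s t z · · · · |>.symm)) hlower'
  rw [fdisc_neg] at h2
  rw [sdisc_eq_fdisc P hP hq fun x _ => hS x, abs_le]
  exact ⟨by linarith, h1⟩

end IsBary

/-- if `S` is a subtriangle of `T = Δ(A,B,C)` with sides parallel to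
those of `T` (i.e. a homothetic image, with positive or negative ratio, contained
in `T`), then `|δ_N(S;P,T)| ≤ 6·D_N^P(P;T)`. -/
theorem sdisc_parallel_subtriangle_le (A B C : Pt) (h : Nondeg A B C)
    (N : ℕ) (hN : 1 ≤ N) (P : Fin N → Pt) (hP : ∀ i, P i ∈ triangle A B C)
    (r : ℝ) (hr : r ≠ 0) (p : Pt)
    (hsub : triangle (p + r • A) (p + r • B) (p + r • C) ⊆ triangle A B C) :
    |sdisc (triangle (p + r • A) (p + r • B) (p + r • C)) P (triangle A B C)|
      ≤ 6 * parDisc P A B C := by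
  obtain ⟨u, v, w, hb⟩ := h.exists_isBary
  have hu : Measurable u := u.continuous_of_finiteDimensional.measurable
  have hv : Measurable v := v.continuous_of_finiteDimensional.measurable
  have hw : Measurable w := w.continuous_of_finiteDimensional.measurable
  have hA := (hb.mem_iff _).1 (hsub (subset_convexHull ℝ _ (Set.mem_insert (p + r • A) _)))
  have hB := (hb.mem_iff _).1 (hsub (subset_convexHull ℝ _ (Set.mem_insert_of_mem _
    (Set.mem_insert (p + r • B) _))))
  have hC := (hb.mem_iff _).1 (hsub (subset_convexHull ℝ _ (Set.mem_insert_of_mem _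
    (Set.mem_insert_of_mem _ (Set.mem_singleton (p + r • C))))))
  have hS := hb.mem_homothetic_iff p hr
  have ha := u.apply_add_smul_sub p A B r
  have hb' := v.apply_add_smul_sub p B C r
  have hc := w.apply_add_smul_sub p C A r
  have hvB := v.apply_add_smul_sub p A C r
  have hsum := hb.sum (p + r • A)
  rw [hb.left.1, hb.middle.1] at ha
  rw [hb.middle.2.1, hb.right.2.1] at hb'
  rw [hb.right.2.2, hb.left.2.2] at hc
  rw [hb.left.2.1, hb.right.2.1] at hvB
  generalize u (p + r • B) = a at *
  generalize v (p + r • C) = b at *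
  generalize w (p + r • A) = c at *
  have hsum' : a + b + c + r = 1 := by linarith
  rcases lt_or_gt_of_ne hr with hr' | hr'
  · have hdiv : ∀ x, 0 ≤ x / r ↔ x ≤ 0 := fun x => by
      rw [div_nonneg_iff]
      grind
    refine hb.abs_sdisc_le hN hP (q := fun s t z => s ≤ a ∧ t ≤ b ∧ z ≤ c)
      ((measurableSet_le hu measurable_const).inter ((measurableSet_le hv measurable_const).inter
        (measurableSet_le hw measurable_const)))
      (fun x => by simp only [hS, hdiv, sub_nonpos])
      (isCut_Iic (by linarith)) (isCut_Iic (by linarith)) (isCut_Iic (by linarith))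
      (isCut_Iio (by linarith)) (isCut_Iio (by linarith)) (isCut_Iio (by linarith))
      (fun s t z => upperComb_eq_of_neg hr' hsum') (fun s t z => lowerComb_eq_of_neg hr' hsum')
      (upperComb_vertex_of_neg (by linarith) (by linarith) (by linarith) hr' hsum')
      (lowerComb_vertex_of_neg (by linarith) (by linarith) (by linarith) hr' hsum')
  · have hdiv : ∀ x, 0 ≤ x / r ↔ 0 ≤ x := fun x => by rw [le_div_iff₀ hr', zero_mul]
    refine hb.abs_sdisc_le hN hP (q := fun s t z => a ≤ s ∧ b ≤ t ∧ c ≤ z)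
      ((measurableSet_le measurable_const hu).inter ((measurableSet_le measurable_const hv).inter
        (measurableSet_le measurable_const hw)))
      (fun x => by simp only [hS, hdiv, sub_nonneg])
      (isCut_Iio (by linarith)) (isCut_Iio (by linarith)) (isCut_Iio (by linarith))
      (isCut_Iic_inter_Iio (by linarith)) (isCut_Iic_inter_Iio (by linarith))
      (isCut_Iic_inter_Iio (by linarith))
      (fun s t z => upperComb_eq_of_pos hr' hsum') (fun s t z => lowerComb_eq_of_pos hr' hsum')
      (upperComb_vertex_of_pos (by linarith) (by linarith) (by linarith) hr' hsum')
      (lowerComb_vertex_of_pos (by linarith) (by linarith) (by linarith) hr' hsum')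
end
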